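/- arXiv:0811.4545 — 6 statements merged into one kernel-verified Lean document; each statement's English description precedes it below -/
import Mathlib

section
/- Let 𝓕 = (S, I, R, f, f₁) be a frame. Then there exists a unique element π ∈ S such that f(a) = π·f₁(a) for all a ∈ I. Moreover, if t ∈ S ⊗_{f,S} I satisfies f₁^♯(t) = 1, then π = f^♯(t), where f^♯ is the linearization of the f-linear map f|_I : I → S. -/
open scoped BigOperators

/-- A frame `(S, I, R, f, f₁)` (with `R = S ⧸ I` implicit):
`S` is a local ring, `I ⊆ S` an ideal, `f` a ring endomorphism of `S`,
`f₁ : I → S` an `f`-linear map such that `f₁(I)` generates `S` as an `S`-module. -/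
structure Frame (S : Type) [CommRing S] where
  isLocal : IsLocalRing S
  I : Ideal S
  f : S →+* S
  f₁ : I →ₛₗ[f] S
  span_f₁ : Ideal.span (Set.range ⇑f₁) = ⊤

/-- A window `(P, Q, F, F₁)` over a frame. -/
structure IsWindow {S : Type} [CommRing S] (𝓕 : Frame S)
    {P : Type} [AddCommGroup P] [Module S P] [Module.Free S P] [Module.Finite S P]
    (Q : Submodule S P) (F : P →ₛₗ[𝓕.f] P) (F₁ : Q →ₛₗ[𝓕.f] P) : Prop where
  smul_le : 𝓕.I • (⊤ : Submodule S P) ≤ Q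
  quot_free : ∃ n : ℕ, Nonempty ((P ⧸ Q) ≃ₗ[S] (Fin n → S ⧸ 𝓕.I))
  F₁_smul : ∀ (a : 𝓕.I) (x : P),
    F₁ ⟨(a : S) • x, smul_le (Submodule.smul_mem_smul a.2 Submodule.mem_top)⟩
      = 𝓕.f₁ a • F x
  span_F₁ : Submodule.span S (Set.range ⇑F₁) = ⊤

namespace Frame

variable {S : Type} [CommRing S] (𝓕 : Frame S)

theorem f_mul_f₁_comm (a b : 𝓕.I) : 𝓕.f a * 𝓕.f₁ b = 𝓕.f b * 𝓕.f₁ a := by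
  rw [← smul_eq_mul, ← smul_eq_mul, ← map_smulₛₗ, ← map_smulₛₗ]
  exact congrArg 𝓕.f₁ (Subtype.ext (mul_comm (a : S) b))

theorem exists_mul_f_eq_mul_f₁ {x : S} (hx : x ∈ Ideal.span (Set.range 𝓕.f₁)) :
    ∃ p : S, ∀ b : 𝓕.I, x * 𝓕.f b = p * 𝓕.f₁ b := by
  induction hx using Submodule.span_induction with
  | mem x hx =>
    obtain ⟨a, rfl⟩ := hx
    exact ⟨𝓕.f a, fun b => by rw [𝓕.f_mul_f₁_comm a b, mul_comm]⟩
  | zero => exact ⟨0, fun b => by simp⟩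
  | add x y _ _ hx hy =>
    obtain ⟨p, hp⟩ := hx
    obtain ⟨q, hq⟩ := hy
    exact ⟨p + q, fun b => by rw [add_mul, add_mul, hp, hq]⟩
  | smul s x _ hx =>
    obtain ⟨p, hp⟩ := hx
    exact ⟨s * p, fun b => by rw [smul_eq_mul, mul_assoc, mul_assoc, hp]⟩

theorem eq_of_forall_mul_f₁_eq {p q : S} (h : ∀ a : 𝓕.I, p * 𝓕.f₁ a = q * 𝓕.f₁ a) :
    p = q := by
  have key : LinearMap.mulLeft S p = LinearMap.mulLeft S q :=
    LinearMap.ext_on_range 𝓕.span_f₁ h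
  simpa using LinearMap.congr_fun key 1

end Frame

/-- There is a unique `π ∈ S` with `f(a) = π · f₁(a)` for all `a ∈ I`;
moreover, whenever a finite family `(sᵢ, aᵢ)` satisfies `∑ sᵢ · f₁(aᵢ) = 1`
(i.e. `f₁^♯(t) = 1` for `t = ∑ sᵢ ⊗ aᵢ`), we have `π = ∑ sᵢ · f(aᵢ)` (i.e. `π = f^♯(t)`). -/
theorem frame_exists_unique_pi {S : Type} [CommRing S] (𝓕 : Frame S) :
    (∃! π : S, ∀ a : 𝓕.I, 𝓕.f a = π * 𝓕.f₁ a) ∧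
    (∀ π : S, (∀ a : 𝓕.I, 𝓕.f a = π * 𝓕.f₁ a) →
      ∀ (n : ℕ) (s : Fin n → S) (a : Fin n → 𝓕.I),
        (∑ i, s i * 𝓕.f₁ (a i)) = 1 → π = ∑ i, s i * 𝓕.f (a i)) := by
  refine ⟨?_, fun π hπ n s a hs => ?_⟩
  · obtain ⟨p, hp⟩ := 𝓕.exists_mul_f_eq_mul_f₁ (x := 1) (𝓕.span_f₁ ▸ Submodule.mem_top)
    have hp' : ∀ a : 𝓕.I, 𝓕.f a = p * 𝓕.f₁ a := fun a => by rw [← hp, one_mul]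
    exact ⟨p, hp', fun q hq => 𝓕.eq_of_forall_mul_f₁_eq fun a => by rw [← hq, hp']⟩
  · calc π = π * ∑ i, s i * 𝓕.f₁ (a i) := by rw [hs, mul_one]
      _ = ∑ i, s i * 𝓕.f (a i) := by
        rw [Finset.mul_sum]
        exact Finset.sum_congr rfl fun i _ => by rw [hπ, mul_left_comm]
end

section
/- Let 𝓕 = (S, I, R, f, f₁) be a frame and let 𝒫 = (P, Q, F, F₁) be a window over 𝓕. Then 𝒫 admits a normal decomposition: there exist finite free S-submodules L and T of P such that P = L ⊕ T as S-modules and Q = L ⊕ IT. -/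
open scoped BigOperators

/-- A complement of a submodule in a finite free module over a local ring is finite free. -/
theorem Submodule.finite_and_free_of_isCompl {S P : Type*} [CommRing S] [IsLocalRing S]
    [AddCommGroup P] [Module S P] [Module.Free S P] [Module.Finite S P]
    {L T : Submodule S P} (h : IsCompl L T) : Module.Finite S L ∧ Module.Free S L := by
  have hproj : (L.projectionOnto T h) ∘ₗ L.subtype = LinearMap.id := by
    ext x
    simp
  have hfin : Module.Finite S L := .of_surjective (L.projectionOnto T h) fun x =>
    ⟨x, congrArg (· x) hproj⟩
  have : Module.Projective S L := .of_split L.subtype (L.projectionOnto T h) hproj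
  exact ⟨hfin, Module.free_of_flat_of_isLocalRing⟩

/-- The kernel of a linear map is complementary to the range of any section of it. -/
theorem LinearMap.isCompl_ker_range_of_comp_eq_id {S P M : Type*} [CommRing S]
    [AddCommGroup P] [Module S P] [AddCommGroup M] [Module S M]
    {φ : P →ₗ[S] M} {s : M →ₗ[S] P} (h : φ ∘ₗ s = LinearMap.id) :
    IsCompl (LinearMap.ker φ) (LinearMap.range s) := by
  have hs : ∀ y, φ (s y) = y := fun y => congrArg (· y) h
  refine ⟨Submodule.disjoint_def.2 ?_, Submodule.codisjoint_iff_exists_add_eq.2 fun x => ?_⟩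
  · rintro _ hx ⟨y, rfl⟩
    rw [LinearMap.mem_ker, hs] at hx
    rw [hx, map_zero]
  · exact ⟨x - s (φ x), s (φ x), by simp [hs], ⟨_, rfl⟩, by simp⟩

/-- Vectors with all coordinates in `I` lie in `I • ⊤`. -/
theorem Ideal.mem_smul_top_of_forall_mem {S : Type*} [CommRing S] (I : Ideal S)
    {ι : Type*} [Fintype ι] {x : ι → S} (hx : ∀ i, x i ∈ I) :
    x ∈ I • (⊤ : Submodule S (ι → S)) := by
  classical
  rw [pi_eq_sum_univ' x]
  exact Submodule.sum_mem _ fun i _ => Submodule.smul_mem_smul (hx i) Submodule.mem_top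

/-- If `P ⧸ Q` is finite free over `S ⧸ I` and `I • P ≤ Q`, with `S` local and `I` proper, then
`P` splits as `L ⊕ T` with `T` free and `Q = L ⊕ I • T`. -/
theorem Submodule.exists_isCompl_eq_sup_smul {S P : Type*} [CommRing S] [IsLocalRing S]
    [AddCommGroup P] [Module S P] [Module.Projective S P] {I : Ideal S} (hI : I ≠ ⊤)
    {Q : Submodule S P} (hQ : I • (⊤ : Submodule S P) ≤ Q) {n : ℕ}
    (e : (P ⧸ Q) ≃ₗ[S] (Fin n → S ⧸ I)) :
    ∃ L T : Submodule S P, IsCompl L T ∧ Q = L ⊔ I • T := by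
  let π : (Fin n → S) →ₗ[S] (Fin n → S ⧸ I) := (Submodule.mkQ I).compLeft (Fin n)
  have hπ_surj : Function.Surjective π := (Submodule.mkQ_surjective I).comp_left
  have hπ_ker : ∀ x, π x = 0 → x ∈ I • (⊤ : Submodule S (Fin n → S)) := fun x hx =>
    I.mem_smul_top_of_forall_mem fun i => (Submodule.Quotient.mk_eq_zero I).1 (congrFun hx i)
  obtain ⟨φ, hφ⟩ := Module.projective_lifting_property π (e.toLinearMap ∘ₗ Q.mkQ) hπ_surj
  have hφ_apply : ∀ p, π (φ p) = e (Q.mkQ p) := fun p => congrArg (· p) hφ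
  have hφ_range : (⊤ : Submodule S (Fin n → S)) ≤ LinearMap.range φ := by
    refine Submodule.le_of_le_smul_of_le_jacobson_bot Module.Finite.fg_top
      ((IsLocalRing.le_maximalIdeal hI).trans (IsLocalRing.maximalIdeal_le_jacobson _))
      fun y _ => ?_
    obtain ⟨p, hp⟩ := Q.mkQ_surjective (e.symm (π y))
    have hy : π (y - φ p) = 0 := by
      rw [map_sub, hφ_apply, hp, e.apply_symm_apply, sub_self]
    rw [← add_sub_cancel (φ p) y]
    exact Submodule.add_mem_sup ⟨p, rfl⟩ (hπ_ker _ hy)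
  obtain ⟨s, hs⟩ := φ.exists_rightInverse_of_surjective (top_le_iff.1 hφ_range)
  refine ⟨LinearMap.ker φ, LinearMap.range s, LinearMap.isCompl_ker_range_of_comp_eq_id hs,
    le_antisymm (fun q hq => ?_) (sup_le (fun q hq => ?_) ?_)⟩
  · have hφq : φ q ∈ I • (⊤ : Submodule S (Fin n → S)) := hπ_ker _ <| by
      rw [hφ_apply, Submodule.mkQ_apply, (Submodule.Quotient.mk_eq_zero Q).2 hq, map_zero]
    have hsq : s (φ q) ∈ I • LinearMap.range s := by
      rw [LinearMap.range_eq_map, ← Submodule.map_smul'']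
      exact Submodule.mem_map_of_mem hφq
    rw [← sub_add_cancel q (s (φ q))]
    refine Submodule.add_mem_sup ?_ hsq
    rw [LinearMap.mem_ker, map_sub, sub_eq_zero]
    exact (congrArg (· (φ q)) hs).symm
  · rw [← Submodule.Quotient.mk_eq_zero Q, ← Submodule.mkQ_apply]
    apply e.injective
    rw [← hφ_apply, LinearMap.mem_ker.1 hq, map_zero, map_zero]
  · exact (Submodule.smul_mono le_rfl le_top).trans hQ

/-- Every window admits a normal decomposition: finite free submodules
`L, T ⊆ P` with `P = L ⊕ T` and `Q = L ⊕ I·T`. -/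
theorem window_normal_decomposition {S : Type} [CommRing S] (𝓕 : Frame S)
    {P : Type} [AddCommGroup P] [Module S P] [Module.Free S P] [Module.Finite S P]
    (Q : Submodule S P) (F : P →ₛₗ[𝓕.f] P) (F₁ : Q →ₛₗ[𝓕.f] P)
    (hW : IsWindow 𝓕 Q F F₁) :
    ∃ L T : Submodule S P, IsCompl L T ∧ Q = L ⊔ 𝓕.I • T ∧
      Module.Free S L ∧ Module.Finite S L ∧ Module.Free S T ∧ Module.Finite S T := by
  have := 𝓕.isLocal
  suffices ∃ L T : Submodule S P, IsCompl L T ∧ Q = L ⊔ 𝓕.I • T by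
    obtain ⟨L, T, h, hQ⟩ := this
    obtain ⟨hLfin, hLfree⟩ := Submodule.finite_and_free_of_isCompl h
    obtain ⟨hTfin, hTfree⟩ := Submodule.finite_and_free_of_isCompl h.symm
    exact ⟨L, T, h, hQ, hLfree, hLfin, hTfree, hTfin⟩
  by_cases hI : 𝓕.I = ⊤
  · refine ⟨⊤, ⊥, isCompl_top_bot, ?_⟩
    have hQ := hW.smul_le
    rw [hI, Submodule.top_smul] at hQ
    rw [top_sup_eq, top_le_iff.1 hQ]
  · obtain ⟨n, ⟨e⟩⟩ := hW.quot_free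
    exact Submodule.exists_isCompl_eq_sup_smul hI hW.smul_le e
end

section
/- Let α : 𝓕 → 𝓕' be a u-morphism of frames and let 𝒫 be a window over 𝓕. Then there exists a window α_*𝒫 over 𝓕' together with an α-morphism ι : 𝒫 → α_*𝒫 such that for every window 𝒫' over 𝓕', composition with ι is a bijection Hom_{𝓕'}(α_*𝒫, 𝒫') → Hom_α(𝒫, 𝒫'); this property determines α_*𝒫 uniquely up to unique isomorphism. Explicitly, if (L, T, Ψ) is a normal decomposition of 𝒫, then a normal decomposition of α_*𝒫 is (S' ⊗_S L, S' ⊗_S T, Ψ') with Ψ'(s' ⊗ l) = u·f'(s')·ι(Ψ(l)) for l ∈ L and Ψ'(s' ⊗ t) = f'(s')·ι(Ψ(t)) for t ∈ T. -/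
open scoped BigOperators

/-- A bundled window over a frame. -/
structure Window {S : Type} [CommRing S] (𝓕 : Frame S) where
  P : Type
  [addCommGroup : AddCommGroup P]
  [module : Module S P]
  [free : Module.Free S P]
  [finite : Module.Finite S P]
  Q : Submodule S P
  F : P →ₛₗ[𝓕.f] P
  F₁ : Q →ₛₗ[𝓕.f] P
  isWindow : IsWindow 𝓕 Q F F₁

attribute [instance] Window.addCommGroup Window.module Window.free Window.finite

/-- A morphism of windows over a fixed frame. -/
structure WindowHom {S : Type} [CommRing S] {𝓕 : Frame S} (𝒳 𝒴 : Window 𝓕) where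
  g : 𝒳.P →ₗ[S] 𝒴.P
  mapQ : ∀ x ∈ 𝒳.Q, g x ∈ 𝒴.Q
  commF : ∀ x, 𝒴.F (g x) = g (𝒳.F x)
  commF₁ : ∀ (x : 𝒳.Q) (h : g x ∈ 𝒴.Q), 𝒴.F₁ ⟨g x, h⟩ = g (𝒳.F₁ x)

theorem WindowHom.ext' {S : Type} [CommRing S] {𝓕 : Frame S} {𝒳 𝒴 : Window 𝓕}
    {a b : WindowHom 𝒳 𝒴} (h : a.g = b.g) : a = b := by
  cases a; cases b; cases h; rfl

instance WindowCategory {S : Type} [CommRing S] (𝓕 : Frame S) :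
    CategoryTheory.Category (Window 𝓕) where
  Hom := WindowHom
  id 𝒳 := ⟨LinearMap.id, fun _ h => h, fun _ => rfl, fun x _ => by simp⟩
  comp {𝒳₁ 𝒳₂ 𝒳₃} a b :=
    ⟨b.g.comp a.g, fun x hx => b.mapQ _ (a.mapQ x hx),
     fun x => by simp [b.commF, a.commF],
     fun x h => by
       have h₂ : a.g x ∈ 𝒳₂.Q := a.mapQ _ x.2
       exact (b.commF₁ ⟨a.g x, h₂⟩ (by simpa using h)).trans
         (congrArg b.g (a.commF₁ x h₂))⟩
  id_comp _ := WindowHom.ext' rfl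
  comp_id _ := WindowHom.ext' rfl
  assoc _ _ _ := WindowHom.ext' rfl

/-- An `α`-morphism of windows, for a `u`-morphism of frames with underlying
ring homomorphism `α : S → S'`. -/
structure AlphaHom {S S' : Type} [CommRing S] [CommRing S'] {𝓕 : Frame S} {𝓕' : Frame S'}
    (u : S') (α : S →+* S') (𝒳 : Window 𝓕) (𝒴 : Window 𝓕') where
  g : 𝒳.P →ₛₗ[α] 𝒴.P
  mapQ : ∀ x ∈ 𝒳.Q, g x ∈ 𝒴.Q
  commF : ∀ x, 𝒴.F (g x) = g (𝒳.F x)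
  commF₁ : ∀ (x : 𝒳.Q) (h : g x ∈ 𝒴.Q), 𝒴.F₁ ⟨g x, h⟩ = u • g (𝒳.F₁ x)

/-- A `u`-morphism of frames `α : 𝓕 → 𝓕'`. A morphism of frames is a `1`-morphism. -/
structure IsFrameHom {S S' : Type} [CommRing S] [CommRing S'] (𝓕 : Frame S) (𝓕' : Frame S')
    (u : S') (α : S →+* S') : Prop where
  mapI : ∀ a ∈ 𝓕.I, α a ∈ 𝓕'.I
  commf : ∀ s, 𝓕'.f (α s) = α (𝓕.f s)
  commf₁ : ∀ (a : 𝓕.I) (h : α a ∈ 𝓕'.I), 𝓕'.f₁ ⟨α a, h⟩ = u * α (𝓕.f₁ a)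

/-- `α` is crystalline: the base change functor `α_*` (characterized on objects by
the universal property `Hom_α(𝒳, 𝒵) = Hom_{𝓕'}(α_*𝒳, 𝒵)` via a natural `α`-morphism
`𝒳 → α_*𝒳`) exists and is an equivalence of categories. -/
def IsCrystalline {S S' : Type} [CommRing S] [CommRing S'] (𝓕 : Frame S) (𝓕' : Frame S')
    (u : S') (α : S →+* S') : Prop :=
  ∃ (G : CategoryTheory.Functor (Window 𝓕) (Window 𝓕'))
    (ι : ∀ 𝒳 : Window 𝓕, AlphaHom u α 𝒳 (G.obj 𝒳)),
    (∀ (𝒳₁ 𝒳₂ : Window 𝓕) (h : 𝒳₁ ⟶ 𝒳₂) (x : 𝒳₁.P),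
        (G.map h).g ((ι 𝒳₁).g x) = (ι 𝒳₂).g (h.g x)) ∧
    (∀ (𝒳 : Window 𝓕) (𝒵 : Window 𝓕') (g : AlphaHom u α 𝒳 𝒵),
        ∃! h : G.obj 𝒳 ⟶ 𝒵, ∀ x, h.g ((ι 𝒳).g x) = g.g x) ∧
    G.IsEquivalence

theorem Frame.f₁_mul {S : Type} [CommRing S] (𝓕 : Frame S) (s : S) (a : 𝓕.I)
    (h : s * (a : S) ∈ 𝓕.I) : 𝓕.f₁ ⟨s * a, h⟩ = 𝓕.f s * 𝓕.f₁ a :=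
  𝓕.f₁.map_smulₛₗ s a

/-- The Hodge filtration of a window is cut out by coordinates: there are a linear map
`p : P → Sⁿ` and a section of it such that `Q` is the preimage of `Iⁿ`. -/
theorem Window.exists_coordinates {S : Type} [CommRing S] {𝓕 : Frame S} (𝒳 : Window 𝓕) :
    ∃ (n : ℕ) (p : 𝒳.P →ₗ[S] (Fin n → S)) (c : Fin n → 𝒳.P),
      (∀ i, p (c i) = Pi.single i 1) ∧ ∀ x, x ∈ 𝒳.Q ↔ ∀ i, p x i ∈ 𝓕.I := by
  have := 𝓕.isLocal
  obtain ⟨n, ⟨e⟩⟩ := 𝒳.isWindow.quot_free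
  by_cases hI : 𝓕.I = ⊤
  · refine ⟨0, 0, Fin.elim0, fun i => i.elim0, fun x => ⟨fun _ i => i.elim0, fun _ => ?_⟩⟩
    have h := 𝒳.isWindow.smul_le
    rw [hI, Submodule.top_smul] at h
    exact h Submodule.mem_top
  let q : (Fin n → S) →ₗ[S] (Fin n → S ⧸ 𝓕.I) :=
    LinearMap.pi fun i => (Submodule.mkQ 𝓕.I).comp (LinearMap.proj i)
  have hq : Function.Surjective q := fun y =>
    ⟨fun i => (Ideal.Quotient.mk_surjective (y i)).choose,
      funext fun i => (Ideal.Quotient.mk_surjective (y i)).choose_spec⟩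
  obtain ⟨p, hp⟩ := Module.projective_lifting_property q (e.toLinearMap.comp 𝒳.Q.mkQ) hq
  have hpx : ∀ x, q (p x) = e (𝒳.Q.mkQ x) := fun x => LinearMap.congr_fun hp x
  have hq0 : ∀ y, q y = 0 ↔ ∀ i, y i ∈ 𝓕.I := fun y => by
    rw [funext_iff]
    exact forall_congr' fun i => Submodule.Quotient.mk_eq_zero 𝓕.I
  have hQ : ∀ x, x ∈ 𝒳.Q ↔ ∀ i, p x i ∈ 𝓕.I := fun x => by
    rw [← hq0, hpx, LinearEquiv.map_eq_zero_iff, Submodule.mkQ_apply,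
      Submodule.Quotient.mk_eq_zero]
  have hmem : ∀ y : Fin n → S, (∀ i, y i ∈ 𝓕.I) → y ∈ 𝓕.I • (⊤ : Submodule S (Fin n → S)) := by
    intro y hy
    rw [pi_eq_sum_univ' y]
    exact Submodule.sum_mem _ fun i _ => Submodule.smul_mem_smul (hy i) Submodule.mem_top
  have hsurj : LinearMap.range p = ⊤ := by
    rw [eq_top_iff]
    refine Submodule.le_of_le_smul_of_le_jacobson_bot (I := 𝓕.I) Module.Finite.fg_top
      ((IsLocalRing.le_maximalIdeal hI).trans (IsLocalRing.jacobson_eq_maximalIdeal ⊥ bot_ne_top).ge)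
      fun y _ => ?_
    obtain ⟨x, hx⟩ := 𝒳.Q.mkQ_surjective (e.symm (q y))
    have hyx : q (y - p x) = 0 := by rw [map_sub, hpx, hx, e.apply_symm_apply, sub_self]
    rw [← add_sub_cancel (p x) y]
    exact Submodule.add_mem_sup ⟨x, rfl⟩ (hmem _ ((hq0 _).1 hyx))
  choose c hc using fun i : Fin n => LinearMap.range_eq_top.1 hsurj (Pi.single i 1)
  exact ⟨n, p, c, hc, hQ⟩

/-- `j : P → P'` exhibits the `S'`-module `P'` as the scalar extension of `P` along `α`, with
the universal property stated for maps semilinear over endomorphisms of `S'`. -/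
structure IsScalarExtension {S S' P P' : Type} [CommRing S] [CommRing S'] [AddCommGroup P]
    [Module S P] [AddCommGroup P'] [Module S' P'] (α : S →+* S') (j : P →ₛₗ[α] P') : Prop where
  span_range : Submodule.span S' (Set.range j) = ⊤
  exists_lift : ∀ (σ : S' →+* S') {M : Type} [AddCommGroup M] [Module S' M] (g : P →+ M),
    (∀ s x, g (s • x) = σ (α s) • g x) → ∃ h : P' →ₛₗ[σ] M, ∀ x, h (j x) = g x

theorem exists_isScalarExtension {S S' : Type} [CommRing S] [CommRing S'] (α : S →+* S')
    (P : Type) [AddCommGroup P] [Module S P] [Module.Free S P] [Module.Finite S P] :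
    ∃ (n : ℕ) (j : P →ₛₗ[α] (Fin n → S')), IsScalarExtension α j := by
  classical
  obtain ⟨n, ⟨b⟩⟩ : ∃ n : ℕ, Nonempty (Module.Basis (Fin n) S P) :=
    ⟨_, ⟨(Module.Free.chooseBasis S P).reindex (Fintype.equivFin _)⟩⟩
  let j : P →ₛₗ[α] (Fin n → S') :=
    { toFun := fun x i => α (b.repr x i)
      map_add' := fun x y => by ext i; simp
      map_smul' := fun s x => by ext i; simp }
  have hj : ∀ i, j (b i) = Pi.single i 1 := fun i => by
    ext k
    by_cases h : i = k <;> simp [j, h, Ne.symm]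
  refine ⟨n, j, ?_, ?_⟩
  · rw [eq_top_iff]
    rintro y -
    rw [pi_eq_sum_univ' y]
    refine Submodule.sum_mem _ fun i _ => Submodule.smul_mem _ _ (Submodule.subset_span ⟨b i, ?_⟩)
    rw [hj]
  · intro σ M _ _ g hg
    refine ⟨{ toFun := fun y => ∑ i, σ (y i) • g (b i), map_add' := ?_, map_smul' := ?_ }, ?_⟩
    · intro x y
      simp [add_smul, Finset.sum_add_distrib]
    · intro s x
      simp [mul_smul, Finset.smul_sum]
    · intro x
      conv_rhs => rw [← b.sum_repr x, map_sum]
      simp_rw [hg]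
      rfl

namespace IsScalarExtension

variable {S S' P P' : Type} [CommRing S] [CommRing S'] [AddCommGroup P]
    [Module S P] [AddCommGroup P'] [Module S' P'] {α : S →+* S'} {j : P →ₛₗ[α] P'}

theorem hom_ext (hj : IsScalarExtension α j) {σ : S' →+* S'} {M : Type} [AddCommGroup M]
    [Module S' M] {g h : P' →ₛₗ[σ] M} (H : ∀ x, g (j x) = h (j x)) : g = h :=
  LinearMap.ext_on_range hj.span_range H

theorem isCompl (hj : IsScalarExtension α j) {L T : Submodule S P} (h : IsCompl L T) :
    IsCompl (Submodule.span S' (j '' L)) (Submodule.span S' (j '' T)) := by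
  have hP : ∀ x, ∃ l ∈ L, ∃ t ∈ T, l + t = x := fun x =>
    Submodule.mem_sup.1 (h.sup_eq_top ▸ Submodule.mem_top)
  constructor
  · let e : P →ₗ[S] P := L.subtype.comp (L.projectionOnto T h)
    obtain ⟨e', he'⟩ := hj.exists_lift (RingHom.id S') (j.toAddMonoidHom.comp e.toAddMonoidHom)
      fun s x => by simp
    have hL : Submodule.span S' (j '' L) ≤ LinearMap.eqLocus e' LinearMap.id := by
      rw [Submodule.span_le]
      rintro _ ⟨l, hl, rfl⟩
      have : e l = l := congrArg Subtype.val (Submodule.projectionOnto_apply_left h ⟨l, hl⟩)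
      simp [LinearMap.mem_eqLocus, he', this]
    have hT : Submodule.span S' (j '' T) ≤ LinearMap.ker e' := by
      rw [Submodule.span_le]
      rintro _ ⟨t, ht, rfl⟩
      have : e t = 0 := congrArg Subtype.val (Submodule.projectionOnto_apply_right h ⟨t, ht⟩)
      simp [he', this]
    rw [Submodule.disjoint_def]
    exact fun x hxL hxT => (hL hxL).symm.trans (hT hxT)
  · rw [codisjoint_iff, eq_top_iff, ← hj.span_range, Submodule.span_le]
    rintro _ ⟨x, rfl⟩
    obtain ⟨l, hl, t, ht, rfl⟩ := hP x
    rw [map_add]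
    exact Submodule.add_mem_sup (Submodule.subset_span ⟨l, hl, rfl⟩)
      (Submodule.subset_span ⟨t, ht, rfl⟩)

end IsScalarExtension

theorem Submodule.free_and_finite_of_isCompl {R M : Type} [CommRing R] [IsLocalRing R]
    [AddCommGroup M] [Module R M] [Module.Free R M] [Module.Finite R M] {p q : Submodule R M}
    (h : IsCompl p q) : Module.Free R p ∧ Module.Finite R p := by
  have hfin : Module.Finite R p := Module.Finite.of_surjective (p.projectionOnto q h)
    fun x => ⟨x, Submodule.projectionOnto_apply_left h x⟩
  have : Module.Projective R p := Module.Projective.of_split p.subtype (p.projectionOnto q h)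
    (LinearMap.ext fun x => Submodule.projectionOnto_apply_left h x)
  exact ⟨Module.free_of_flat_of_isLocalRing, hfin⟩

/-- The submodule generated by the image of `Q` and `I' P'`. -/
def extendedFiltration {S S' P P' : Type} [CommRing S] [CommRing S'] [AddCommGroup P]
    [Module S P] [AddCommGroup P'] [Module S' P'] {α : S →+* S'} (j : P →ₛₗ[α] P')
    (Q : Submodule S P) (I' : Ideal S') : Submodule S' P' :=
  Submodule.span S' (j '' Q) ⊔ I' • ⊤

section extendedFiltration

variable {S S' P P' : Type} [CommRing S] [CommRing S'] [AddCommGroup P]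
    [Module S P] [AddCommGroup P'] [Module S' P'] {α : S →+* S'} {j : P →ₛₗ[α] P'}
    {Q : Submodule S P} {I' : Ideal S'}

theorem map_mem_extendedFiltration {x : P} (hx : x ∈ Q) : j x ∈ extendedFiltration j Q I' :=
  Submodule.mem_sup_left (Submodule.subset_span ⟨x, hx, rfl⟩)

theorem smul_mem_extendedFiltration {a : S'} (ha : a ∈ I') (x : P') :
    a • x ∈ extendedFiltration j Q I' :=
  Submodule.mem_sup_right (Submodule.smul_mem_smul ha Submodule.mem_top)

theorem extendedFiltration_le {N : Submodule S' P'} (h₁ : ∀ x ∈ Q, j x ∈ N)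
    (h₂ : ∀ a ∈ I', ∀ x, a • x ∈ N) : extendedFiltration j Q I' ≤ N :=
  sup_le (Submodule.span_le.2 <| by rintro _ ⟨x, hx, rfl⟩; exact h₁ x hx)
    (Submodule.smul_le.2 fun a ha x _ => h₂ a ha x)

theorem extendedFiltration_hom_ext {σ : S' →+* S'} {M : Type} [AddCommGroup M] [Module S' M]
    {g h : extendedFiltration j Q I' →ₛₗ[σ] M}
    (h₁ : ∀ x (hx : x ∈ Q), g ⟨j x, map_mem_extendedFiltration hx⟩ =
      h ⟨j x, map_mem_extendedFiltration hx⟩)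
    (h₂ : ∀ a (ha : a ∈ I') x, g ⟨a • x, smul_mem_extendedFiltration ha x⟩ =
      h ⟨a • x, smul_mem_extendedFiltration ha x⟩) : g = h := by
  have key : extendedFiltration j Q I' ≤
      (LinearMap.eqLocus g h).map (extendedFiltration j Q I').subtype :=
    extendedFiltration_le (fun x hx => ⟨⟨j x, _⟩, h₁ x hx, rfl⟩)
      (fun a ha x => ⟨⟨a • x, _⟩, h₂ a ha x, rfl⟩)
  ext ⟨x, hx⟩
  obtain ⟨y, hy, rfl⟩ := key hx
  exact hy

theorem extendedFiltration_eq (hj : IsScalarExtension α j) {I : Ideal S}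
    (hI : ∀ a ∈ I, α a ∈ I') {L T : Submodule S P} (h : IsCompl L T) (hQ : Q = L ⊔ I • T) :
    extendedFiltration j Q I' =
      Submodule.span S' (j '' L) ⊔ I' • Submodule.span S' (j '' T) := by
  apply le_antisymm
  · refine sup_le ?_ ?_
    · rw [Submodule.span_le]
      rintro _ ⟨x, hx, rfl⟩
      have hle : Q ≤ (Submodule.span S' (j '' L) ⊔ I' • Submodule.span S' (j '' T)).comap j := by
        rw [hQ]
        refine sup_le (fun l hl => Submodule.mem_sup_left (Submodule.subset_span ⟨l, hl, rfl⟩))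
          (Submodule.smul_le.2 fun a ha t ht => ?_)
        rw [Submodule.mem_comap, map_smulₛₗ]
        exact Submodule.mem_sup_right
          (Submodule.smul_mem_smul (hI a ha) (Submodule.subset_span ⟨t, ht, rfl⟩))
      exact hle hx
    · rw [← (hj.isCompl h).sup_eq_top, Submodule.smul_sup]
      exact sup_le_sup_right Submodule.smul_le_right _
  · refine sup_le ?_ ?_
    · refine le_sup_of_le_left (Submodule.span_mono (Set.image_mono ?_))
      exact hQ ▸ (le_sup_left : L ≤ L ⊔ I • T)
    · exact le_sup_of_le_right (Submodule.smul_mono le_rfl le_top)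

end extendedFiltration

section baseChange

variable {S S' : Type} [CommRing S] [CommRing S'] {u : S'} {α : S →+* S'} {𝓕' : Frame S'}
  {𝓕 : Frame S}

/-- The relation between `F` and `F₁` on `Q`, after scalar extension. -/
theorem IsFrameHom.smul_map_F₁ (hα : IsFrameHom 𝓕 𝓕' u α) (𝒳 : Window 𝓕) {P' : Type}
    [AddCommGroup P'] [Module S' P'] (j : 𝒳.P →ₛₗ[α] P') (a : 𝓕'.I) (x : 𝒳.Q) :
    (𝓕'.f a * u) • j (𝒳.F₁ x) = 𝓕'.f₁ a • j (𝒳.F x) := by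
  let N : Ideal S :=
    { carrier := {r | α r • (𝓕'.f a * u) • j (𝒳.F₁ x) = α r • 𝓕'.f₁ a • j (𝒳.F x)}
      add_mem' := fun {r s} hr hs => by
        simp only [Set.mem_ofPred_eq, map_add, add_smul] at hr hs ⊢
        rw [hr, hs]
      zero_mem' := by simp
      smul_mem' := fun s r hr => by
        simp only [Set.mem_ofPred_eq, smul_eq_mul, map_mul, mul_smul (α s)] at hr ⊢
        rw [hr] }
  have hN : Ideal.span (Set.range 𝓕.f₁) ≤ N := by
    rw [Ideal.span_le]
    rintro _ ⟨b, rfl⟩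
    have hb := hα.mapI b b.2
    have h₁ : 𝓕'.f a * (u * α (𝓕.f₁ b)) = α (𝓕.f b) * 𝓕'.f₁ a := by
      rw [← hα.commf₁ b hb, ← hα.commf, ← 𝓕'.f₁_mul a ⟨α b, hb⟩ (𝓕'.I.mul_mem_left _ hb),
        ← 𝓕'.f₁_mul (α b) a (𝓕'.I.mul_mem_left _ a.2)]
      congr 2
      exact mul_comm _ _
    have h₂ : α (𝓕.f b) • j (𝒳.F₁ x) = α (𝓕.f₁ b) • j (𝒳.F x) := by
      rw [← map_smulₛₗ, ← map_smulₛₗ j, ← 𝒳.isWindow.F₁_smul, ← map_smulₛₗ 𝒳.F₁]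
      rfl
    change α (𝓕.f₁ b) • (𝓕'.f a * u) • j (𝒳.F₁ x) = α (𝓕.f₁ b) • 𝓕'.f₁ a • j (𝒳.F x)
    rw [smul_comm _ (𝓕'.f₁ a), ← h₂, smul_smul, smul_smul, mul_comm (𝓕'.f₁ a), ← h₁]
    congr 1
    ring
  have h1 : (1 : S) ∈ N := hN (𝓕.span_f₁ ▸ Submodule.mem_top)
  simpa [N] using h1

theorem IsFrameHom.exists_isWindow (hα : IsFrameHom 𝓕 𝓕' u α) (hu : IsUnit u) (𝒳 : Window 𝓕)
    {P' : Type} [AddCommGroup P'] [Module S' P'] [Module.Free S' P'] [Module.Finite S' P']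
    {j : 𝒳.P →ₛₗ[α] P'} (hj : IsScalarExtension α j) :
    ∃ (F' : P' →ₛₗ[𝓕'.f] P') (F₁' : extendedFiltration j 𝒳.Q 𝓕'.I →ₛₗ[𝓕'.f] P'),
      IsWindow 𝓕' (extendedFiltration j 𝒳.Q 𝓕'.I) F' F₁' ∧ (∀ x, F' (j x) = j (𝒳.F x)) ∧
      ∀ x : 𝒳.Q, F₁' ⟨j x, map_mem_extendedFiltration x.2⟩ = u • j (𝒳.F₁ x) := by
  obtain ⟨n, p, c, hc, hQ⟩ := 𝒳.exists_coordinates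
  let e : 𝒳.P →ₗ[S] 𝒳.P := LinearMap.id - ∑ i, ((LinearMap.proj i).comp p).smulRight (c i)
  have he : ∀ x, e x = x - ∑ i, p x i • c i := fun x => by simp [e]
  have hpe : ∀ x, p (e x) = 0 := fun x => by
    rw [he, map_sub, map_sum]
    simp only [map_smul, hc]
    rw [sub_eq_zero]
    ext k
    simp [Pi.single_apply]
  have heQ : ∀ x, e x ∈ 𝒳.Q := fun x => by simp [hQ, hpe]
  obtain ⟨p', hp'⟩ := hj.exists_lift (RingHom.id S')
    ((AddMonoidHom.compLeft α.toAddMonoidHom (Fin n)).comp p.toAddMonoidHom)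
    (fun s x => by ext; simp)
  replace hp' : ∀ x i, p' (j x) i = α (p x i) := fun x i => congrFun (hp' x) i
  obtain ⟨F', hF'⟩ := hj.exists_lift 𝓕'.f (j.toAddMonoidHom.comp 𝒳.F.toAddMonoidHom)
    (fun s x => by simp [hα.commf])
  replace hF' : ∀ x, F' (j x) = j (𝒳.F x) := hF'
  let eQ : 𝒳.P →ₗ[S] 𝒳.Q := e.codRestrict 𝒳.Q heQ
  obtain ⟨Φ, hΦ⟩ := hj.exists_lift 𝓕'.f
    ((DistribSMul.toAddMonoidHom P' u).comp
      (j.toAddMonoidHom.comp (𝒳.F₁.toAddMonoidHom.comp eQ.toAddMonoidHom)))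
    (fun s x => by simp [hα.commf, smul_comm u])
  replace hΦ : ∀ x, Φ (j x) = u • j (𝒳.F₁ (eQ x)) := hΦ
  have hp'Q : ∀ i, ∀ x ∈ extendedFiltration j 𝒳.Q 𝓕'.I, p' x i ∈ 𝓕'.I := by
    intro i x hx
    refine extendedFiltration_le (N := Submodule.comap ((LinearMap.proj i).comp p') 𝓕'.I)
      (fun x hx => ?_) (fun a ha x => ?_) hx
    · simpa [hp'] using hα.mapI _ ((hQ x).1 hx i)
    · simpa using 𝓕'.I.mul_mem_right _ ha
  let p₁ : Fin n → (extendedFiltration j 𝒳.Q 𝓕'.I →ₗ[S'] 𝓕'.I) := fun i =>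
    (((LinearMap.proj i).comp p').comp (Submodule.subtype _)).codRestrict 𝓕'.I
      fun x => hp'Q i x x.2
  let F₁' : extendedFiltration j 𝒳.Q 𝓕'.I →ₛₗ[𝓕'.f] P' :=
    { toFun := fun x => Φ x + ∑ i, 𝓕'.f₁ (p₁ i x) • j (𝒳.F (c i))
      map_add' := fun x y => by
        simp only [Submodule.coe_add, map_add, add_smul, Finset.sum_add_distrib]
        abel
      map_smul' := fun s x => by
        simp only [Submodule.coe_smul, map_smul, map_smulₛₗ, smul_add, Finset.smul_sum, smul_smul,
          smul_eq_mul] }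
  have hF₁' : ∀ x : 𝒳.Q, F₁' ⟨j x, map_mem_extendedFiltration x.2⟩ = u • j (𝒳.F₁ x) := by
    intro x
    have hx : x = eQ x + ∑ i, (⟨p x i • c i, 𝒳.isWindow.smul_le (Submodule.smul_mem_smul
        ((hQ x).1 x.2 i) Submodule.mem_top)⟩ : 𝒳.Q) := by
      ext
      simp [eQ, he]
    conv_rhs => rw [hx, map_add, map_sum]
    change Φ (j x) + ∑ i, 𝓕'.f₁ (p₁ i _) • j (𝒳.F (c i)) = _
    rw [hΦ, map_add, smul_add, map_sum, Finset.smul_sum]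
    congr 1
    refine Finset.sum_congr rfl fun i _ => ?_
    rw [𝒳.isWindow.F₁_smul ⟨p x i, (hQ x).1 x.2 i⟩, map_smulₛₗ, smul_smul,
      ← hα.commf₁ _ (hα.mapI _ ((hQ x).1 x.2 i))]
    exact congrArg (𝓕'.f₁ · • _) (Subtype.ext (hp' x i))
  refine ⟨F', F₁', ⟨le_sup_right, ⟨n, ?_⟩, ?_, ?_⟩, hF', hF₁'⟩
  · let q : P' →ₗ[S'] (Fin n → S' ⧸ 𝓕'.I) :=
      LinearMap.pi fun i => (Submodule.mkQ 𝓕'.I).comp ((LinearMap.proj i).comp p')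
    have hsec : ∀ y : Fin n → S', p' (∑ i, y i • j (c i)) = y := fun y => by
      ext k
      simp [hp', hc, Pi.single_apply]
    have hq : Function.Surjective q := fun y => by
      choose z hz using fun i => Submodule.mkQ_surjective 𝓕'.I (y i)
      exact ⟨∑ i, z i • j (c i), funext fun i => by
        change Submodule.mkQ 𝓕'.I (p' _ i) = _
        rw [hsec, hz]⟩
    have hker : LinearMap.ker q = extendedFiltration j 𝒳.Q 𝓕'.I := by
      have hqx : ∀ x, x ∈ LinearMap.ker q ↔ ∀ i, p' x i ∈ 𝓕'.I := fun x => by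
        rw [LinearMap.mem_ker, funext_iff]
        exact forall_congr' fun i => Submodule.Quotient.mk_eq_zero 𝓕'.I
      ext x
      rw [hqx]
      refine ⟨fun hx => ?_, fun hx i => hp'Q i x hx⟩
      let e' : P' →ₗ[S'] P' :=
        LinearMap.id - ∑ i, ((LinearMap.proj i).comp p').smulRight (j (c i))
      have he' : ∀ x, e' x = x - ∑ i, p' x i • j (c i) := fun x => by simp [e']
      have hmem : e' x ∈ extendedFiltration j 𝒳.Q 𝓕'.I := by
        have hle : Submodule.span S' (Set.range j) ≤
            (extendedFiltration j 𝒳.Q 𝓕'.I).comap e' := by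
          rw [Submodule.span_le]
          rintro _ ⟨y, rfl⟩
          have : e' (j y) = j (e y) := by
            rw [he', he, map_sub, map_sum]
            simp [hp']
          rw [SetLike.mem_coe, Submodule.mem_comap, this]
          exact map_mem_extendedFiltration (heQ y)
        exact hle (hj.span_range ▸ Submodule.mem_top)
      rw [← sub_add_cancel x (∑ i, p' x i • j (c i)), ← he']
      exact Submodule.add_mem _ hmem
        (Submodule.sum_mem _ fun i _ => smul_mem_extendedFiltration (hx i) _)
    exact ⟨(Submodule.quotEquivOfEq _ _ hker.symm).trans (q.quotKerEquivOfSurjective hq)⟩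
  · intro a x
    have key : 𝓕'.f a • Φ = 𝓕'.f₁ a •
        (F' - ∑ i, { toFun := fun x => 𝓕'.f (p' x i) • j (𝒳.F (c i))
                     map_add' := fun x y => by simp [add_smul]
                     map_smul' := fun s x => by simp [mul_smul] }) := by
      refine hj.hom_ext fun x => ?_
      simp only [LinearMap.smul_apply, LinearMap.sub_apply, LinearMap.sum_apply, LinearMap.coe_mk,
        AddHom.coe_mk, hΦ, hF', hp']
      rw [smul_smul, hα.smul_map_F₁ 𝒳 j a (eQ x)]
      congr 1
      change j (𝒳.F (e x)) = _
      rw [he, map_sub, map_sub, map_sum, map_sum]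
      simp [hα.commf]
    have hkx := LinearMap.congr_fun key x
    simp only [LinearMap.smul_apply, LinearMap.sub_apply, LinearMap.sum_apply, LinearMap.coe_mk,
        AddHom.coe_mk] at hkx
    change Φ ((a : S') • x) + ∑ i, 𝓕'.f₁ (p₁ i _) • j (𝒳.F (c i)) = _
    rw [map_smulₛₗ, hkx, smul_sub, sub_add_eq_add_sub, sub_eq_iff_eq_add, Finset.smul_sum]
    congr 1
    refine Finset.sum_congr rfl fun i _ => ?_
    rw [smul_smul, mul_comm, ← 𝓕'.f₁_mul (p' x i) a (𝓕'.I.mul_mem_left _ a.2)]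
    refine congrArg (𝓕'.f₁ · • _) (Subtype.ext ?_)
    change p' ((a : S') • x) i = _
    rw [map_smul, Pi.smul_apply, smul_eq_mul, mul_comm]
  · rw [eq_top_iff, ← hj.span_range, Submodule.span_le]
    rintro _ ⟨x, rfl⟩
    have hle : Submodule.span S (Set.range 𝒳.F₁) ≤
        (Submodule.span S' (Set.range F₁')).comap j := by
      rw [Submodule.span_le]
      rintro _ ⟨y, rfl⟩
      rw [SetLike.mem_coe, Submodule.mem_comap, ← Submodule.smul_mem_iff_of_isUnit _ hu, ← hF₁']
      exact Submodule.subset_span ⟨_, rfl⟩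
    exact hle (𝒳.isWindow.span_F₁ ▸ Submodule.mem_top)

end baseChange

/-- Two `α`-morphisms with the universal property of base change have uniquely isomorphic
targets. -/
theorem AlphaHom.existsUnique_iso {S S' : Type} [CommRing S] [CommRing S'] {𝓕 : Frame S}
    {𝓕' : Frame S'} {u : S'} {α : S →+* S'} {𝒳 : Window 𝓕} {𝒴 𝒴' : Window 𝓕'}
    (ι : AlphaHom u α 𝒳 𝒴) (ι' : AlphaHom u α 𝒳 𝒴')
    (h : ∀ (𝒵 : Window 𝓕') (g : AlphaHom u α 𝒳 𝒵),
      ∃! h : 𝒴 ⟶ 𝒵, ∀ x, WindowHom.g h (ι.g x) = g.g x)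
    (h' : ∀ (𝒵 : Window 𝓕') (g : AlphaHom u α 𝒳 𝒵),
      ∃! h : 𝒴' ⟶ 𝒵, ∀ x, WindowHom.g h (ι'.g x) = g.g x) :
    ∃! e : 𝒴 ≅ 𝒴', ∀ x, WindowHom.g e.hom (ι.g x) = ι'.g x := by
  obtain ⟨a, ha, ha'⟩ := h 𝒴' ι'
  obtain ⟨b, hb, -⟩ := h' 𝒴 ι
  refine ⟨⟨a, b, ?_, ?_⟩, ha, fun e he => CategoryTheory.Iso.ext (ha' _ he)⟩
  · refine (h 𝒴 ι).unique (fun x => ?_) (fun x => rfl)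
    change WindowHom.g b (WindowHom.g a (ι.g x)) = _
    rw [ha, hb]
  · refine (h' 𝒴' ι').unique (fun x => ?_) (fun x => rfl)
    change WindowHom.g a (WindowHom.g b (ι'.g x)) = _
    rw [hb, ha]

/-- For a `u`-morphism of frames `α : 𝓕 → 𝓕'` and a window `𝒳` over `𝓕`
there is a base change window `α_*𝒳` over `𝓕'` with an `α`-morphism `ι : 𝒳 → α_*𝒳`
satisfying `Hom_{𝓕'}(α_*𝒳, 𝒵) = Hom_α(𝒳, 𝒵)`; this determines `α_*𝒳` uniquely up to
unique isomorphism, and a normal decomposition `(L, T, Ψ)` of `𝒳` induces the normal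
decomposition `(S' ⊗_S L, S' ⊗_S T, Ψ')` of `α_*𝒳` with `Ψ'(s' ⊗ l) = u·f'(s')·ι(Ψ(l))`
and `Ψ'(s' ⊗ t) = f'(s')·ι(Ψ(t))`. -/
theorem base_change_window_exists {S S' : Type} [CommRing S] [CommRing S']
    {𝓕 : Frame S} {𝓕' : Frame S'} (u : S') (hu : IsUnit u) (α : S →+* S')
    (hα : IsFrameHom 𝓕 𝓕' u α) (𝒳 : Window 𝓕) :
    ∃ (𝒴 : Window 𝓕') (ι : AlphaHom u α 𝒳 𝒴),
      (∀ (𝒵 : Window 𝓕') (g : AlphaHom u α 𝒳 𝒵),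
        ∃! h : 𝒴 ⟶ 𝒵, ∀ x, WindowHom.g h (ι.g x) = g.g x) ∧
      (∀ (𝒴' : Window 𝓕') (ι' : AlphaHom u α 𝒳 𝒴'),
        (∀ (𝒵 : Window 𝓕') (g : AlphaHom u α 𝒳 𝒵),
          ∃! h : 𝒴' ⟶ 𝒵, ∀ x, WindowHom.g h (ι'.g x) = g.g x) →
        ∃! e : 𝒴 ≅ 𝒴', ∀ x, WindowHom.g e.hom (ι.g x) = ι'.g x) ∧
      (∀ L T : Submodule S 𝒳.P, IsCompl L T → 𝒳.Q = L ⊔ 𝓕.I • T →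
        IsCompl (Submodule.span S' (ι.g '' L)) (Submodule.span S' (ι.g '' T)) ∧
        𝒴.Q = Submodule.span S' (ι.g '' L) ⊔ 𝓕'.I • Submodule.span S' (ι.g '' T) ∧
        Module.Free S' (Submodule.span S' (ι.g '' L)) ∧
        Module.Finite S' (Submodule.span S' (ι.g '' L)) ∧
        Module.Free S' (Submodule.span S' (ι.g '' T)) ∧
        Module.Finite S' (Submodule.span S' (ι.g '' T)) ∧
        (∀ (s' : S') (l : 𝒳.Q), (l : 𝒳.P) ∈ L →
          ∀ h : s' • ι.g l ∈ 𝒴.Q,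
            𝒴.F₁ ⟨s' • ι.g l, h⟩ = (u * 𝓕'.f s') • ι.g (𝒳.F₁ l)) ∧
        (∀ (s' : S') (t : 𝒳.P), t ∈ T →
            𝒴.F (s' • ι.g t) = 𝓕'.f s' • ι.g (𝒳.F t))) := by
  have := 𝓕'.isLocal
  obtain ⟨n, j, hj⟩ := exists_isScalarExtension α 𝒳.P
  obtain ⟨F', F₁', hW, hF', hF₁'⟩ := hα.exists_isWindow hu 𝒳 hj
  let 𝒴 : Window 𝓕' := ⟨Fin n → S', extendedFiltration j 𝒳.Q 𝓕'.I, F', F₁', hW⟩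
  let ι : AlphaHom u α 𝒳 𝒴 :=
    ⟨j, fun x hx => map_mem_extendedFiltration hx, hF', fun x _ => hF₁' x⟩
  have huniv : ∀ (𝒵 : Window 𝓕') (g : AlphaHom u α 𝒳 𝒵),
      ∃! h : 𝒴 ⟶ 𝒵, ∀ x, WindowHom.g h (ι.g x) = g.g x := by
    intro 𝒵 g
    obtain ⟨h, hh⟩ := hj.exists_lift (RingHom.id S') g.g.toAddMonoidHom fun s x => by simp
    replace hh : ∀ x, h (j x) = g.g x := hh
    have hQ : ∀ x ∈ extendedFiltration j 𝒳.Q 𝓕'.I, h x ∈ 𝒵.Q := fun x hx =>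
      extendedFiltration_le (N := 𝒵.Q.comap h)
        (fun x hx => by simpa [hh] using g.mapQ x hx)
        (fun a ha x => by
          rw [Submodule.mem_comap, map_smul]
          exact 𝒵.isWindow.smul_le (Submodule.smul_mem_smul ha Submodule.mem_top)) hx
    have hF : 𝒵.F.comp h = h.comp F' := hj.hom_ext fun x => by
      simp [hh, hF', g.commF]
    have hF₁ : 𝒵.F₁.comp (h.restrict hQ) = h.comp F₁' := by
      refine extendedFiltration_hom_ext (fun x hx => ?_) (fun a ha x => ?_)
      · rw [LinearMap.comp_apply, LinearMap.comp_apply, hF₁' ⟨x, hx⟩, map_smul, hh,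
          ← g.commF₁ ⟨x, hx⟩ (g.mapQ x hx)]
        exact congrArg 𝒵.F₁ (Subtype.ext (hh x))
      · rw [LinearMap.comp_apply, LinearMap.comp_apply, hW.F₁_smul ⟨a, ha⟩, map_smul,
          ← LinearMap.comp_apply h F', ← hF, LinearMap.comp_apply, ← 𝒵.isWindow.F₁_smul]
        exact congrArg 𝒵.F₁ (Subtype.ext (map_smul h a x))
    refine ⟨⟨h, hQ, LinearMap.congr_fun hF, fun x _ => LinearMap.congr_fun hF₁ x⟩, hh,
      fun k hk => WindowHom.ext' (hj.hom_ext fun x => ?_)⟩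
    exact (hk x).trans (hh x).symm
  refine ⟨𝒴, ι, huniv, fun 𝒴' ι' h' => ι.existsUnique_iso ι' huniv h', fun L T hLT hQ => ?_⟩
  have hcompl := hj.isCompl hLT
  obtain ⟨hL, hL'⟩ := Submodule.free_and_finite_of_isCompl hcompl
  obtain ⟨hT, hT'⟩ := Submodule.free_and_finite_of_isCompl hcompl.symm
  refine ⟨hcompl, extendedFiltration_eq hj hα.mapI hLT hQ, hL, hL', hT, hT',
    fun s l _ _ => ?_, fun s t _ => ?_⟩
  · have h := F₁'.map_smulₛₗ s ⟨j l, map_mem_extendedFiltration l.2⟩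
    rw [hF₁', smul_smul, mul_comm] at h
    exact h
  · exact (F'.map_smulₛₗ s (j t)).trans (congrArg _ (hF' t))
end

section
/- Let 𝓕 = (S, I, R, f, f₁) be a frame and 𝔞 ⊆ I an ideal of S with 𝔞² = 0, f(𝔞) = 0, f₁(𝔞) ⊆ 𝔞, and f₁ elementwise nilpotent on 𝔞 (for each a ∈ 𝔞 there is n with f₁^n(a) = 0). Let 𝒫 = (P, Q, F, F₁) and 𝒫' = (P, Q, F', F₁') be two windows over 𝓕 with the same underlying pair (P, Q) such that F(x) − F'(x) ∈ 𝔞P for all x ∈ P and F₁(y) − F₁'(y) ∈ 𝔞P for all y ∈ Q. Then there is a unique isomorphism of windows g : 𝒫 → 𝒫' (an S-module automorphism g of P with g(Q) = Q, g∘F = F'∘g and g∘F₁ = F₁'∘g on Q) such that g(x) − x ∈ 𝔞P for all x ∈ P. -/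
open scoped BigOperators

namespace IsWindow

variable {S : Type} [CommRing S] {𝓕 : Frame S}
  {P : Type} [AddCommGroup P] [Module S P]

theorem F_eq_zero_of_mem {𝔞 : Ideal S} (F : P →ₛₗ[𝓕.f] P) (hf𝔞 : ∀ a ∈ 𝔞, 𝓕.f a = 0) {x : P}
    (hx : x ∈ 𝔞 • (⊤ : Submodule S P)) : F x = 0 := by
  induction hx using Submodule.smul_induction_on' with
  | smul r hr z _ => rw [LinearMap.map_smulₛₗ, hf𝔞 r hr, zero_smul]
  | add x _ z _ hx hz => rw [map_add, hx, hz, add_zero]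

theorem eq_zero_of_mem_span_smul {B : Set S} (hB : ∀ b ∈ B, b = 0) {x : P}
    (hx : x ∈ Ideal.span B • (⊤ : Submodule S P)) : x = 0 := by
  rw [Ideal.span_eq_bot.2 hB, Submodule.bot_smul] at hx
  exact hx

section Pairs

variable {Q : Submodule S P} {M : Type} [AddCommGroup M] [Module S M]
  {G : P →ₛₗ[𝓕.f] M} {G₁ : Q →ₛₗ[𝓕.f] M}

/-- A pair `(G, G₁)` with `G₁ (a • x) = f₁ a • G x` is determined by its values on a basis
adapted to `Q`. -/
theorem apply_eq_sum {ι κ : Type} [Fintype ι] [Fintype κ] (b : Module.Basis (ι ⊕ κ) S P)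
    (hIQ : 𝓕.I • (⊤ : Submodule S P) ≤ Q) (hι : ∀ i, b (Sum.inl i) ∈ Q)
    (hκ : ∀ y ∈ Q, ∀ j, b.repr y (Sum.inr j) ∈ 𝓕.I)
    (hG : ∀ (a : 𝓕.I) (x : P) (h : (a : S) • x ∈ Q), G₁ ⟨(a : S) • x, h⟩ = 𝓕.f₁ a • G x)
    (y : Q) :
    G₁ y = ∑ i, 𝓕.f (b.repr y (Sum.inl i)) • G₁ ⟨b (Sum.inl i), hι i⟩ +
      ∑ j, 𝓕.f₁ ⟨b.repr y (Sum.inr j), hκ y y.2 j⟩ • G (b (Sum.inr j)) := by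
  have hmem : ∀ j, b.repr y (Sum.inr j) • b (Sum.inr j) ∈ Q := fun j =>
    hIQ (Submodule.smul_mem_smul (hκ y y.2 j) Submodule.mem_top)
  have hy : y = ∑ i, b.repr y (Sum.inl i) • (⟨b (Sum.inl i), hι i⟩ : Q) +
      ∑ j, (⟨b.repr y (Sum.inr j) • b (Sum.inr j), hmem j⟩ : Q) := by
    apply Subtype.ext
    have := b.sum_repr (y : P)
    rw [Fintype.sum_sum_type] at this
    simpa using this.symm
  conv_lhs => rw [hy]
  rw [map_add, map_sum, map_sum]
  congr 1
  · exact Finset.sum_congr rfl fun i _ => by rw [LinearMap.map_smulₛₗ]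
  · exact Finset.sum_congr rfl fun j _ => hG ⟨_, hκ y y.2 j⟩ _ (hmem j)

end Pairs

variable [Module.Free S P] [Module.Finite S P] {Q : Submodule S P}
  {F : P →ₛₗ[𝓕.f] P} {F₁ : Q →ₛₗ[𝓕.f] P}

theorem exists_surjective (hW : IsWindow 𝓕 Q F F₁) :
    ∃ (n : ℕ) (π : P →ₗ[S] (Fin n → S)), Function.Surjective π ∧
      (∀ x, π x = 0 → x ∈ Q) ∧ ∀ x ∈ Q, ∀ j, π x j ∈ 𝓕.I := by
  have := 𝓕.isLocal
  by_cases hI : 𝓕.I = ⊤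
  · refine ⟨_, (Module.finBasis S P).equivFun.toLinearMap,
      (Module.finBasis S P).equivFun.surjective, fun x _ => ?_, fun x _ j => hI ▸ trivial⟩
    apply hW.smul_le
    rw [hI, Submodule.top_smul]
    trivial
  · obtain ⟨n, ⟨e⟩⟩ := hW.quot_free
    let q : (Fin n → S) →ₗ[S] (Fin n → S ⧸ 𝓕.I) :=
      LinearMap.pi fun j => (Submodule.mkQ 𝓕.I).comp (LinearMap.proj j)
    have hq : Function.Surjective q := fun z => by
      choose w hw using fun j => Submodule.mkQ_surjective 𝓕.I (z j)
      exact ⟨w, funext hw⟩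
    have hq0 : ∀ z, q z = 0 ↔ ∀ j, z j ∈ 𝓕.I := fun z => by
      rw [funext_iff]
      exact forall_congr' fun j => Submodule.Quotient.mk_eq_zero 𝓕.I
    obtain ⟨π, hπ⟩ := Module.projective_lifting_property q (e.toLinearMap.comp Q.mkQ) hq
    have hπ' : ∀ x, q (π x) = e (Q.mkQ x) := fun x => LinearMap.congr_fun hπ x
    have hQ : ∀ x, x ∈ Q ↔ q (π x) = 0 := fun x => by
      rw [hπ', e.map_eq_zero_iff]
      exact (Submodule.Quotient.mk_eq_zero Q).symm
    refine ⟨n, π, ?_, fun x hx => (hQ x).2 (by rw [hx, map_zero]),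
      fun x hx => (hq0 _).1 ((hQ x).1 hx)⟩
    rw [← LinearMap.range_eq_top, eq_top_iff]
    refine Submodule.le_of_le_smul_of_le_jacobson_bot (I := 𝓕.I) Module.Finite.fg_top ?_ ?_
    · rw [IsLocalRing.jacobson_eq_maximalIdeal ⊥ bot_ne_top]
      exact IsLocalRing.le_maximalIdeal hI
    · intro z _
      obtain ⟨x', hx'⟩ := e.surjective (q z)
      obtain ⟨x, rfl⟩ := Q.mkQ_surjective x'
      have hz : ∀ j, (z - π x) j ∈ 𝓕.I := (hq0 _).1 (by rw [map_sub, hπ', hx', sub_self])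
      rw [← add_sub_cancel (π x) z]
      refine Submodule.add_mem_sup ⟨x, rfl⟩ ?_
      rw [← (Pi.basisFun S (Fin n)).sum_repr (z - π x)]
      exact Submodule.sum_mem _ fun j _ => Submodule.smul_mem_smul (hz j) trivial

/-- A normal decomposition of a window, expressed by an adapted basis. -/
theorem exists_basis (hW : IsWindow 𝓕 Q F F₁) :
    ∃ (ι κ : Type) (_ : Fintype ι) (_ : Fintype κ) (b : Module.Basis (ι ⊕ κ) S P),
      (∀ i, b (Sum.inl i) ∈ Q) ∧ ∀ y ∈ Q, ∀ j, b.repr y (Sum.inr j) ∈ 𝓕.I := by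
  have := 𝓕.isLocal
  obtain ⟨n, π, hπ, hker, hQ⟩ := hW.exists_surjective
  obtain ⟨s, hs⟩ := Module.projective_lifting_property π LinearMap.id hπ
  have hs' : ∀ z, π (s z) = z := fun z => LinearMap.congr_fun hs z
  let p : P →ₗ[S] LinearMap.ker π :=
    LinearMap.codRestrict _ (LinearMap.id - s.comp π) fun x => by simp [hs']
  have hp : ∀ l : LinearMap.ker π, p l = l := fun l => by
    apply Subtype.ext
    simp [p]
  have : Module.Finite S (LinearMap.ker π) := Module.Finite.of_surjective p fun l => ⟨l, hp l⟩
  have : Module.Projective S (LinearMap.ker π) :=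
    Module.Projective.of_split (LinearMap.ker π).subtype p (LinearMap.ext hp)
  have : Module.Free S (LinearMap.ker π) := Module.free_of_flat_of_isLocalRing
  let e : P ≃ₗ[S] LinearMap.ker π × (Fin n → S) :=
    LinearEquiv.ofLinearMap (p.prod π) ((LinearMap.ker π).subtype.coprod s)
      (by
        refine LinearMap.ext fun ⟨l, z⟩ => ?_
        refine Prod.ext (Subtype.ext ?_) ?_ <;> simp [p, hs'])
      (LinearMap.ext fun x => by simp [p])
  refine ⟨_, _, inferInstance, inferInstance,
    ((Module.finBasis S (LinearMap.ker π)).prod (Pi.basisFun S (Fin n))).map e.symm,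
    fun i => hker _ ?_, fun y hy j => ?_⟩
  · simp [e]
  · simpa [e] using hQ y hy j

/-- The pair `(F, F₁)` of a window is universal among pairs `(G, G₁)`. -/
theorem exists_lift (hW : IsWindow 𝓕 Q F F₁) {M : Type} [AddCommGroup M] [Module S M]
    (G : P →ₛₗ[𝓕.f] M) (G₁ : Q →ₛₗ[𝓕.f] M)
    (hG : ∀ (a : 𝓕.I) (x : P) (h : (a : S) • x ∈ Q), G₁ ⟨(a : S) • x, h⟩ = 𝓕.f₁ a • G x) :
    ∃ ω : P →ₗ[S] M, ∀ y, ω (F₁ y) = G₁ y := by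
  obtain ⟨ι, κ, _, _, b, hι, hκ⟩ := hW.exists_basis
  let Ψ : P →ₗ[S] P := b.constr S
    (Sum.elim (fun i => F₁ ⟨b (Sum.inl i), hι i⟩) fun j => F (b (Sum.inr j)))
  have hΨl : ∀ i, Ψ (b (Sum.inl i)) = F₁ ⟨b (Sum.inl i), hι i⟩ := fun i => b.constr_basis S _ _
  have hΨr : ∀ j, Ψ (b (Sum.inr j)) = F (b (Sum.inr j)) := fun j => b.constr_basis S _ _
  have hF₁ := apply_eq_sum b hW.smul_le hι hκ (fun a x _ => hW.F₁_smul a x)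
  have hsurj : Function.Surjective Ψ := by
    rw [← LinearMap.range_eq_top, eq_top_iff, ← hW.span_F₁, Submodule.span_le]
    rintro _ ⟨y, rfl⟩
    rw [hF₁ y]
    exact add_mem (sum_mem fun i _ => Submodule.smul_mem _ _ ⟨_, hΨl i⟩)
      (sum_mem fun j _ => Submodule.smul_mem _ _ ⟨_, hΨr j⟩)
  let E := LinearEquiv.ofBijective Ψ
    ⟨OrzechProperty.injective_of_surjective_endomorphism Ψ hsurj, hsurj⟩
  have hE : ∀ x, E.symm (Ψ x) = x := E.symm_apply_apply
  let θ : P →ₗ[S] M := b.constr S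
    (Sum.elim (fun i => G₁ ⟨b (Sum.inl i), hι i⟩) fun j => G (b (Sum.inr j)))
  have hθl : ∀ i, θ (b (Sum.inl i)) = G₁ ⟨b (Sum.inl i), hι i⟩ := fun i => b.constr_basis S _ _
  have hθr : ∀ j, θ (b (Sum.inr j)) = G (b (Sum.inr j)) := fun j => b.constr_basis S _ _
  refine ⟨θ.comp E.symm.toLinearMap, fun y => ?_⟩
  rw [hF₁ y, apply_eq_sum b hW.smul_le hι hκ hG y]
  simp [← hΨl, ← hΨr, hE, hθl, hθr]

theorem apply_mem_of_forall (hW : IsWindow 𝓕 Q F F₁) {M : Type} [AddCommGroup M] [Module S M]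
    (ω : P →ₗ[S] M) (N : Submodule S M) (h : ∀ y, ω (F₁ y) ∈ N) (x : P) : ω x ∈ N := by
  have : (⊤ : Submodule S P) ≤ N.comap ω := by
    rw [← hW.span_F₁, Submodule.span_le]
    rintro _ ⟨y, rfl⟩
    exact h y
  exact this trivial

/-- Compatibility of `g` with `F₁`, `F₁'` implies compatibility with `F`, `F'`. -/
theorem comp_F_of_comp_F₁ {F' : P →ₛₗ[𝓕.f] P} {F₁' : Q →ₛₗ[𝓕.f] P}
    (hW : IsWindow 𝓕 Q F F₁) (hW' : IsWindow 𝓕 Q F' F₁') (g : P →ₗ[S] P)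
    (h : ∀ (y : Q) (h : g y ∈ Q), g (F₁ y) = F₁' ⟨g y, h⟩) (x : P) : g (F x) = F' (g x) := by
  have key : ∀ r ∈ Ideal.span (Set.range 𝓕.f₁), r • (g (F x) - F' (g x)) = 0 := fun r hr => by
    induction hr using Submodule.span_induction with
    | mem r hr =>
      obtain ⟨a, rfl⟩ := hr
      have hmem : ∀ z : P, (a : S) • z ∈ Q := fun z =>
        hW.smul_le (Submodule.smul_mem_smul a.2 trivial)
      have h1 := h ⟨(a : S) • x, hmem x⟩ (by simpa using hmem (g x))
      rw [hW.F₁_smul a x] at h1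
      have h2 := hW'.F₁_smul a (g x)
      simp only [map_smul] at h1
      rw [smul_sub, h1, h2, sub_self]
    | zero => exact zero_smul _ _
    | add r t _ _ hr ht => rw [add_smul, hr, ht, add_zero]
    | smul t r _ hr => rw [smul_assoc, hr, smul_zero]
  rw [𝓕.span_f₁] at key
  simpa [sub_eq_zero] using key 1 trivial

end IsWindow

namespace Frame

variable {S : Type} [CommRing S] (𝓕 : Frame S)

open Classical in
/-- The extension of `f₁` by zero outside `I`. -/
noncomputable def f₁Ext (a : S) : S := if h : a ∈ 𝓕.I then 𝓕.f₁ ⟨a, h⟩ else 0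

theorem f₁Ext_of_mem {a : S} (h : a ∈ 𝓕.I) : 𝓕.f₁Ext a = 𝓕.f₁ ⟨a, h⟩ := dif_pos h

theorem f₁Ext_zero : 𝓕.f₁Ext 0 = 0 := by
  rw [𝓕.f₁Ext_of_mem (zero_mem _)]
  exact map_zero 𝓕.f₁

theorem f₁_mem_span {B : Set S} (hB : B ⊆ 𝓕.I) {r : S} (hr : r ∈ Ideal.span B) (h : r ∈ 𝓕.I) :
    𝓕.f₁ ⟨r, h⟩ ∈ Ideal.span (𝓕.f₁Ext '' B) := by
  induction hr using Submodule.span_induction with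
  | mem r hr => exact Ideal.subset_span ⟨r, hr, 𝓕.f₁Ext_of_mem h⟩
  | zero =>
    rw [show 𝓕.f₁ ⟨0, h⟩ = 0 from map_zero 𝓕.f₁]
    exact zero_mem _
  | add r t hr ht hr' ht' =>
    have hrI := Ideal.span_le.2 hB hr
    have htI := Ideal.span_le.2 hB ht
    rw [show 𝓕.f₁ ⟨r + t, h⟩ = 𝓕.f₁ ⟨r, hrI⟩ + 𝓕.f₁ ⟨t, htI⟩ from map_add 𝓕.f₁ ⟨r, hrI⟩ ⟨t, htI⟩]
    exact add_mem (hr' _) (ht' _)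
  | smul t r hr hr' =>
    have hrI := Ideal.span_le.2 hB hr
    rw [show 𝓕.f₁ ⟨t • r, h⟩ = 𝓕.f t • 𝓕.f₁ ⟨r, hrI⟩ from LinearMap.map_smulₛₗ 𝓕.f₁ t ⟨r, hrI⟩]
    exact Submodule.smul_mem _ _ (hr' _)

variable {𝓕}

theorem exists_iterate_f₁Ext_eq_zero {𝔞 : Ideal S} (h𝔞I : 𝔞 ≤ 𝓕.I)
    (h𝔞 : ∀ a ∈ 𝔞, 𝓕.f₁Ext a ∈ 𝔞)
    (hnil : ∀ c : ℕ → S, c 0 ∈ 𝔞 →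
      (∀ j, ∃ h : c j ∈ 𝓕.I, c (j + 1) = 𝓕.f₁ ⟨c j, h⟩) → ∃ m, c m = 0)
    {B : Set S} (hfin : B.Finite) (hB : B ⊆ 𝔞) : ∃ m, ∀ b ∈ B, 𝓕.f₁Ext^[m] b = 0 := by
  have hone : ∀ b ∈ B, ∃ m, 𝓕.f₁Ext^[m] b = 0 := fun b hb => by
    have hmem : ∀ j, 𝓕.f₁Ext^[j] b ∈ 𝔞 := fun j => by
      induction j with
      | zero => exact hB hb
      | succ j ih =>
        rw [Function.iterate_succ_apply']
        exact h𝔞 _ ih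
    refine hnil (fun j => 𝓕.f₁Ext^[j] b) (hB hb) fun j => ⟨h𝔞I (hmem j), ?_⟩
    rw [Function.iterate_succ_apply', 𝓕.f₁Ext_of_mem]
  choose! m hm using hone
  obtain ⟨k, hk⟩ := (hfin.image m).bddAbove
  refine ⟨k, fun b hb => ?_⟩
  have hle : m b ≤ k := hk ⟨b, hb, rfl⟩
  rw [← Nat.sub_add_cancel hle, Function.iterate_add_apply, hm b hb]
  exact Function.iterate_fixed 𝓕.f₁Ext_zero _

end Frame

namespace IsWindow

variable {S : Type} [CommRing S] {𝓕 : Frame S}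
  {P : Type} [AddCommGroup P] [Module S P] [Module.Free S P] [Module.Finite S P]
  {Q : Submodule S P} {F F' : P →ₛₗ[𝓕.f] P} {F₁ F₁' : Q →ₛₗ[𝓕.f] P}

theorem F₁_mem_span_smul (hW : IsWindow 𝓕 Q F F₁) {B : Set S} (hB : B ⊆ 𝓕.I) {x : P}
    (hx : x ∈ Ideal.span B • (⊤ : Submodule S P)) (h : x ∈ Q) :
    F₁ ⟨x, h⟩ ∈ Ideal.span (𝓕.f₁Ext '' B) • (⊤ : Submodule S P) := by
  have hBQ : Ideal.span B • (⊤ : Submodule S P) ≤ Q :=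
    (Submodule.smul_mono_left (Ideal.span_le.2 hB)).trans hW.smul_le
  induction hx using Submodule.smul_induction_on' with
  | smul r hr z _ =>
    have hrI := Ideal.span_le.2 hB hr
    rw [hW.F₁_smul ⟨r, hrI⟩ z]
    exact Submodule.smul_mem_smul (𝓕.f₁_mem_span hB hr hrI) trivial
  | add x hx z hz ihx ihz =>
    rw [show F₁ ⟨x + z, h⟩ = F₁ ⟨x, hBQ hx⟩ + F₁ ⟨z, hBQ hz⟩ from
      map_add F₁ ⟨x, hBQ hx⟩ ⟨z, hBQ hz⟩]
    exact add_mem (ihx _) (ihz _)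

theorem exists_finite_span_smul {𝔞 : Ideal S} (ω : P →ₗ[S] P)
    (hω : ∀ x, ω x ∈ 𝔞 • (⊤ : Submodule S P)) :
    ∃ B : Set S, B.Finite ∧ B ⊆ 𝔞 ∧ ∀ x, ω x ∈ Ideal.span B • (⊤ : Submodule S P) := by
  let b := Module.Free.chooseBasis S P
  have hcoord : ∀ x ∈ 𝔞 • (⊤ : Submodule S P), ∀ i, b.repr x i ∈ 𝔞 := fun x hx i => by
    induction hx using Submodule.smul_induction_on' with
    | smul r hr z _ => simpa using 𝔞.mul_mem_right _ hr
    | add x _ z _ hx hz => simpa using add_mem hx hz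
  refine ⟨Set.range fun ij : _ × _ => b.repr (ω (b ij.1)) ij.2, Set.finite_range _, ?_, ?_⟩
  · rintro _ ⟨ij, rfl⟩
    exact hcoord _ (hω _) _
  · intro x
    rw [← b.sum_repr x, map_sum]
    refine sum_mem fun i _ => ?_
    rw [map_smul, ← b.sum_repr (ω (b i))]
    exact Submodule.smul_mem _ _ (sum_mem fun j _ =>
      Submodule.smul_mem_smul (Ideal.subset_span ⟨(i, j), rfl⟩) trivial)

section Equation

variable {𝔞 : Ideal S}

theorem exists_solution (hW : IsWindow 𝓕 Q F F₁) (hW' : IsWindow 𝓕 Q F' F₁')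
    (h𝔞I : 𝔞 ≤ 𝓕.I) (h𝔞 : ∀ a ∈ 𝔞, 𝓕.f₁Ext a ∈ 𝔞) (hf𝔞 : ∀ a ∈ 𝔞, 𝓕.f a = 0) (k : ℕ) :
    ∀ (B : Set S) (W : P →ₗ[S] P), B ⊆ 𝔞 → (∀ b ∈ B, 𝓕.f₁Ext^[k] b = 0) →
      (∀ x, W x ∈ Ideal.span B • (⊤ : Submodule S P)) →
      ∃ ω : P →ₗ[S] P, (∀ x, ω x ∈ 𝔞 • (⊤ : Submodule S P)) ∧
        ∀ (y : Q) (h : ω y ∈ Q), ω (F₁ y) = W (F₁ y) + F₁' ⟨ω y, h⟩ := by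
  have h𝔞Q : 𝔞 • (⊤ : Submodule S P) ≤ Q :=
    (Submodule.smul_mono_left h𝔞I).trans hW.smul_le
  induction k with
  | zero =>
    intro B W _ hk hWB
    refine ⟨0, fun x => zero_mem _, fun y h => ?_⟩
    rw [eq_zero_of_mem_span_smul hk (hWB (F₁ y)),
      show F₁' ⟨(0 : P →ₗ[S] P) y, h⟩ = 0 from map_zero F₁']
    simp
  | succ k ih =>
    intro B W hB hk hWB
    have hW𝔞 : ∀ x, W x ∈ 𝔞 • (⊤ : Submodule S P) := fun x =>
      Submodule.smul_mono_left (Ideal.span_le.2 hB) (hWB x)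
    obtain ⟨W', hW'F₁⟩ := hW.exists_lift (0 : P →ₛₗ[𝓕.f] P)
      (F₁'.comp (W.restrict fun x _ => h𝔞Q (hW𝔞 x) : Q →ₗ[S] Q)) (fun a x h => by
        have h1 := hW'.F₁_smul a (W x)
        rw [F_eq_zero_of_mem F' hf𝔞 (hW𝔞 x), smul_zero] at h1
        rw [LinearMap.zero_apply, smul_zero, ← h1, LinearMap.comp_apply]
        exact congrArg F₁' (Subtype.ext (map_smul W (a : S) x)))
    obtain ⟨ω', hω', hω'F₁⟩ := ih (𝓕.f₁Ext '' B) W'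
      (by
        rintro _ ⟨b, hb, rfl⟩
        exact h𝔞 b (hB hb))
      (by
        rintro _ ⟨b, hb, rfl⟩
        exact hk b hb)
      (hW.apply_mem_of_forall W' _ fun y => by
        rw [hW'F₁]
        exact hW'.F₁_mem_span_smul (hB.trans h𝔞I) (hWB y) (h𝔞Q (hW𝔞 y)))
    refine ⟨W + ω', fun x => add_mem (hW𝔞 x) (hω' x), fun y h => ?_⟩
    rw [LinearMap.add_apply, hω'F₁ y (h𝔞Q (hω' y)), hW'F₁]
    congr 1
    exact (map_add F₁' ⟨W y, h𝔞Q (hW𝔞 y)⟩ ⟨ω' y, h𝔞Q (hω' y)⟩).symm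

theorem eq_zero_of_comp_F₁ (hW : IsWindow 𝓕 Q F F₁) (hW' : IsWindow 𝓕 Q F' F₁')
    (h𝔞I : 𝔞 ≤ 𝓕.I) (h𝔞 : ∀ a ∈ 𝔞, 𝓕.f₁Ext a ∈ 𝔞) (δ : P →ₗ[S] P)
    (hδ : ∀ (y : Q) (h : δ y ∈ Q), δ (F₁ y) = F₁' ⟨δ y, h⟩) (k : ℕ) :
    ∀ B : Set S, B ⊆ 𝔞 → (∀ b ∈ B, 𝓕.f₁Ext^[k] b = 0) →
      (∀ x, δ x ∈ Ideal.span B • (⊤ : Submodule S P)) → δ = 0 := by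
  induction k with
  | zero => exact fun B _ hk hδB => LinearMap.ext fun x => eq_zero_of_mem_span_smul hk (hδB x)
  | succ k ih =>
    intro B hB hk hδB
    have hδQ : ∀ x, δ x ∈ Q := fun x =>
      hW.smul_le (Submodule.smul_mono_left (Ideal.span_le.2 (hB.trans h𝔞I)) (hδB x))
    refine ih (𝓕.f₁Ext '' B) ?_ ?_ (hW.apply_mem_of_forall δ _ fun y => ?_)
    · rintro _ ⟨b, hb, rfl⟩
      exact h𝔞 b (hB hb)
    · rintro _ ⟨b, hb, rfl⟩
      exact hk b hb
    · rw [hδ y (hδQ y)]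
      exact hW'.F₁_mem_span_smul (hB.trans h𝔞I) (hδB y) (hδQ y)

end Equation

end IsWindow

theorem LinearMap.apply_apply_eq_zero_of_sq_eq_bot {S P : Type} [CommRing S] [AddCommGroup P]
    [Module S P] {𝔞 : Ideal S} (hsq : 𝔞 * 𝔞 = ⊥) (ω : P →ₗ[S] P)
    (hω : ∀ x, ω x ∈ 𝔞 • (⊤ : Submodule S P)) (x : P) : ω (ω x) = 0 := by
  have h : ∀ z ∈ 𝔞 • (⊤ : Submodule S P), ω z ∈ (𝔞 * 𝔞) • (⊤ : Submodule S P) := fun z hz => by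
    induction hz using Submodule.smul_induction_on' with
    | smul r hr z _ =>
      rw [map_smul, Submodule.mul_smul]
      exact Submodule.smul_mem_smul hr (hω z)
    | add x _ z _ hx hz =>
      rw [map_add]
      exact add_mem hx hz
  simpa [hsq] using h _ (hω x)

/-- Let `𝔞 ⊆ I` be an ideal with `𝔞² = 0`, `f(𝔞) = 0`, `f₁(𝔞) ⊆ 𝔞` and
`f₁` elementwise nilpotent on `𝔞`. If `(P, Q, F, F₁)` and `(P, Q, F', F₁')` are windows
with `F ≡ F'` and `F₁ ≡ F₁'` modulo `𝔞P`, then there is a unique isomorphism of windows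
`g : (P, Q, F, F₁) ≅ (P, Q, F', F₁')` with `g ≡ id` modulo `𝔞P`. -/
theorem unique_iso_congruent_windows {S : Type} [CommRing S] (𝓕 : Frame S)
    {P : Type} [AddCommGroup P] [Module S P] [Module.Free S P] [Module.Finite S P]
    (Q : Submodule S P)
    (F F' : P →ₛₗ[𝓕.f] P) (F₁ F₁' : Q →ₛₗ[𝓕.f] P)
    (hW : IsWindow 𝓕 Q F F₁) (hW' : IsWindow 𝓕 Q F' F₁')
    (𝔞 : Ideal S) (h𝔞I : 𝔞 ≤ 𝓕.I) (hsq : 𝔞 * 𝔞 = ⊥)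
    (hf𝔞 : ∀ a ∈ 𝔞, 𝓕.f a = 0)
    (hf₁𝔞 : ∀ a, ∀ h : a ∈ 𝓕.I, a ∈ 𝔞 → (𝓕.f₁ ⟨a, h⟩ : S) ∈ 𝔞)
    (hnil : ∀ c : ℕ → S, c 0 ∈ 𝔞 →
      (∀ j, ∃ h : c j ∈ 𝓕.I, c (j + 1) = 𝓕.f₁ ⟨c j, h⟩) → ∃ m, c m = 0)
    (hF : ∀ x : P, F x - F' x ∈ 𝔞 • (⊤ : Submodule S P))
    (hF₁ : ∀ y : Q, F₁ y - F₁' y ∈ 𝔞 • (⊤ : Submodule S P)) :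
    ∃! g : P →ₗ[S] P, Function.Bijective g ∧
      Submodule.map g Q = Q ∧
      (∀ x : P, g (F x) = F' (g x)) ∧
      (∀ (y : Q) (h : g y ∈ Q), g (F₁ y) = F₁' ⟨g y, h⟩) ∧
      (∀ x : P, g x - x ∈ 𝔞 • (⊤ : Submodule S P)) := by
  have h𝔞 : ∀ a ∈ 𝔞, 𝓕.f₁Ext a ∈ 𝔞 := fun a ha => by
    rw [𝓕.f₁Ext_of_mem (h𝔞I ha)]
    exact hf₁𝔞 a (h𝔞I ha) ha
  have h𝔞Q : 𝔞 • (⊤ : Submodule S P) ≤ Q :=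
    (Submodule.smul_mono_left h𝔞I).trans hW.smul_le
  have hF₁_sub : ∀ (x z : P) (hx : x ∈ Q) (hz : z ∈ Q) (h : x - z ∈ Q),
      F₁' ⟨x - z, h⟩ = F₁' ⟨x, hx⟩ - F₁' ⟨z, hz⟩ := fun x z hx hz _ =>
    map_sub F₁' ⟨x, hx⟩ ⟨z, hz⟩
  obtain ⟨W, hWF₁⟩ := hW.exists_lift (F' - F) (F₁' - F₁) fun a x h => by
    rw [LinearMap.sub_apply, LinearMap.sub_apply, hW.F₁_smul, hW'.F₁_smul, smul_sub]
  have hW𝔞 : ∀ x, W x ∈ 𝔞 • (⊤ : Submodule S P) := hW.apply_mem_of_forall W _ fun y => by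
    rw [hWF₁, LinearMap.sub_apply, ← neg_sub]
    exact neg_mem (hF₁ y)
  obtain ⟨B, hfin, hB, hWB⟩ := IsWindow.exists_finite_span_smul W hW𝔞
  obtain ⟨m, hm⟩ := Frame.exists_iterate_f₁Ext_eq_zero h𝔞I h𝔞 hnil hfin hB
  obtain ⟨ω, hω, hωF₁⟩ := hW.exists_solution hW' h𝔞I h𝔞 hf𝔞 m B W hB hm hWB
  have hωω := LinearMap.apply_apply_eq_zero_of_sq_eq_bot hsq ω hω
  obtain ⟨g₀, hg₀⟩ : ∃ g₀ : P →ₗ[S] P, ∀ x, g₀ x = x + ω x :=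
    ⟨LinearMap.id + ω, fun _ => rfl⟩
  have hgF₁ : ∀ (y : Q) (h : g₀ y ∈ Q),
      g₀ (F₁ y) = F₁' ⟨g₀ y, h⟩ := fun y h => by
    have h1 : F₁' ⟨g₀ y, h⟩ = F₁' y + F₁' ⟨ω y, h𝔞Q (hω y)⟩ := by
      rw [← map_add]
      exact congrArg F₁' (Subtype.ext (hg₀ y))
    rw [h1, hg₀, hωF₁ y (h𝔞Q (hω y)), hWF₁, LinearMap.sub_apply]
    abel
  have hinv : ∀ x, g₀ (x - ω x) = x := fun x => by simp [hg₀, hωω]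
  refine ⟨g₀, ⟨⟨fun x z hxz => ?_, fun x => ⟨x - ω x, hinv x⟩⟩, ?_,
    hW.comp_F_of_comp_F₁ hW' _ hgF₁, hgF₁, fun x => by simpa [hg₀] using hω x⟩, ?_⟩
  · have hleft : ∀ x, g₀ x - ω (g₀ x) = x := fun x => by
      simp [hg₀, hωω]
    rw [← hleft x, hxz, hleft]
  · apply le_antisymm
    · rintro _ ⟨x, hx, rfl⟩
      exact hg₀ x ▸ add_mem hx (h𝔞Q (hω x))
    · exact fun x hx => ⟨x - ω x, sub_mem hx (h𝔞Q (hω x)), hinv x⟩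
  · rintro g ⟨-, hgQ, -, hg₁, hg⟩
    have hδ𝔞 : ∀ x, (g - g₀) x ∈ 𝔞 • (⊤ : Submodule S P) := fun x => by
      have := sub_mem (hg x) (hω x)
      rwa [sub_sub, ← hg₀] at this
    obtain ⟨C, hCfin, hC, hδC⟩ := IsWindow.exists_finite_span_smul _ hδ𝔞
    obtain ⟨k, hk⟩ := Frame.exists_iterate_f₁Ext_eq_zero h𝔞I h𝔞 hnil hCfin hC
    refine sub_eq_zero.1 (hW.eq_zero_of_comp_F₁ hW' h𝔞I h𝔞 _ (fun y h => ?_) k C hC hk hδC)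
    have hgy : g y ∈ Q := hgQ.le (Submodule.mem_map_of_mem y.2)
    have hωy : g₀ y ∈ Q := hg₀ y ▸ add_mem y.2 (h𝔞Q (hω y))
    rw [LinearMap.sub_apply, hg₁ y hgy, hgF₁ y hωy]
    exact (hF₁_sub _ _ hgy hωy h).symm
end

section
/- Let p be a prime and let R be a noetherian complete local ring with maximal ideal 𝔪 and perfect residue field k of characteristic p. Then there is a unique subring 𝕎(R) of the ring of p-typical Witt vectors W(R) which is stable under the Witt vector Frobenius f, such that the projection W(R) → W(k) maps 𝕎(R) surjectively onto W(k) with kernel 𝕎(R) ∩ W(𝔪) equal to Ŵ(𝔪), where Ŵ(𝔪) ⊆ W(𝔪) is the set of Witt vectors with coefficients in 𝔪 whose coefficients converge to zero 𝔪-adically. -/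
open WittVector in
/-- `x ∈ Ŵ(𝔟)`: all coefficients of the Witt vector `x` lie in `𝔟` and converge to zero
`𝔪`-adically (for every `n`, all but finitely many coefficients lie in `𝔪^n`). -/
def MemHatW (p : ℕ) [Fact p.Prime] {R : Type} [CommRing R] (𝔪 𝔟 : Ideal R)
    (x : WittVector p R) : Prop :=
  (∀ i, x.coeff i ∈ 𝔟) ∧ ∀ n : ℕ, ∀ᶠ i in Filter.atTop, x.coeff i ∈ 𝔪 ^ n

open WittVector in
/-- `T` is the subring `𝕎(R) ⊆ W(R)`: it is stable under the Frobenius, maps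
surjectively onto `W(k)` under the projection (induced by the residue map `ρ : R → k`),
and the kernel of `T → W(k)` is `Ŵ(𝔪)`. -/
def IsSpecialSubring (p : ℕ) [Fact p.Prime] {R k : Type} [CommRing R] [CommRing k]
    (𝔪 : Ideal R) (ρ : R →+* k) (T : Subring (WittVector p R)) : Prop :=
  (∀ x ∈ T, frobenius x ∈ T) ∧
  (∀ y : WittVector p k, ∃ x ∈ T, WittVector.map ρ x = y) ∧
  (∀ x : WittVector p R, (x ∈ T ∧ WittVector.map ρ x = 0) ↔ MemHatW p 𝔪 𝔪 x)

namespace WittVector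

variable {p : ℕ} [hp : Fact p.Prime]

section Teichmuller

variable {R S : Type*} [CommRing R] [CommRing S]

/-- The Witt vector whose `i`-th coefficient is `r ^ p ^ i * x.coeff i`; it equals the product of
the Teichmüller representative of `r` and `x`, see `teichmuller_mul_eq_rescale`. -/
def rescale (r : R) (x : WittVector p R) : WittVector p R :=
  mk p fun i => r ^ p ^ i * x.coeff i

theorem map_rescale (f : R →+* S) (r : R) (x : WittVector p R) :
    map f (rescale r x) = rescale (f r) (map f x) := by
  ext i
  simp [rescale, map_coeff]

theorem ghostComponent_rescale (r : R) (x : WittVector p R) (n : ℕ) :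
    ghostComponent n (rescale r x) = r ^ p ^ n * ghostComponent n x := by
  rw [ghostComponent_apply, ghostComponent_apply, aeval_wittPolynomial, aeval_wittPolynomial,
    Finset.mul_sum]
  refine Finset.sum_congr rfl fun i hi => ?_
  have hi : i ≤ n := Nat.lt_succ_iff.mp (Finset.mem_range.mp hi)
  simp only [rescale, coeff_mk]
  rw [mul_pow, ← pow_mul, ← pow_add, Nat.add_sub_cancel' hi]
  ring

theorem ghostMap_injective_mvPolynomial_int (σ : Type*) :
    Function.Injective (ghostMap : WittVector p (MvPolynomial σ ℤ) → ℕ → MvPolynomial σ ℤ) := by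
  intro x y hxy
  apply map_injective (MvPolynomial.map (Int.castRingHom ℚ))
    (MvPolynomial.map_injective _ Int.cast_injective)
  apply (ghostMap.bijective_of_invertible p (MvPolynomial σ ℚ)).1
  have key : ∀ z : WittVector p (MvPolynomial σ ℤ),
      ghostMap (map (MvPolynomial.map (Int.castRingHom ℚ)) z) =
        fun n => MvPolynomial.map (Int.castRingHom ℚ) (ghostMap z n) := by
    intro z
    ext1 n
    simp only [ghostMap_apply, ghostComponent_apply, aeval_wittPolynomial, map_coeff, map_sum,
      map_mul, map_pow, map_natCast]
  rw [key, key, hxy]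

theorem teichmuller_mul_eq_rescale (r : R) (x : WittVector p R) :
    teichmuller p r * x = rescale r x := by
  obtain ⟨r, rfl⟩ := MvPolynomial.counit_surjective R r
  obtain ⟨x, rfl⟩ := map_surjective (p := p) _ (MvPolynomial.counit_surjective R) x
  have h : teichmuller p r * x = rescale r x := by
    apply ghostMap_injective_mvPolynomial_int
    ext1 n
    rw [ghostMap_apply, ghostMap_apply, map_mul, ghostComponent_rescale,
      ghostComponent_teichmuller]
  have := congrArg (map (MvPolynomial.counit R)) h
  rw [map_mul, map_teichmuller, map_rescale] at this
  exact this

theorem teichmuller_mul_coeff (r : R) (x : WittVector p R) (i : ℕ) :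
    (teichmuller p r * x).coeff i = r ^ p ^ i * x.coeff i := by
  rw [teichmuller_mul_eq_rescale, rescale, coeff_mk]

theorem map_frobenius (f : R →+* S) (x : WittVector p R) :
    map f (frobenius x) = frobenius (map f x) := by
  ext i
  rw [map_coeff, coeff_frobenius, coeff_frobenius, MvPolynomial.aeval_def,
    MvPolynomial.aeval_def, ← MvPolynomial.coe_eval₂Hom, ← MvPolynomial.coe_eval₂Hom,
    MvPolynomial.map_eval₂Hom]
  congr 2
  exact RingHom.ext_int _ _

theorem frobenius_teichmuller (r : R) :
    frobenius (teichmuller p r) = teichmuller p (r ^ p) := by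
  obtain ⟨r, rfl⟩ := MvPolynomial.counit_surjective R r
  have h : frobenius (teichmuller p r) = teichmuller p (r ^ p) := by
    apply ghostMap_injective_mvPolynomial_int
    ext1 n
    rw [ghostMap_apply, ghostMap_apply, ghostComponent_frobenius, ghostComponent_teichmuller,
      ghostComponent_teichmuller, ← pow_mul, pow_succ']
  have := congrArg (map (MvPolynomial.counit R)) h
  rwa [map_frobenius, map_teichmuller, map_teichmuller, map_pow] at this

end Teichmuller

section Filtration

variable {R : Type*} [CommRing R]

/-- The polynomials whose `j`-th coefficient lies in `F j`, for a multiplicative filtration `F`. -/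
def filtrationSubring (F : ℕ → Ideal R) (h0 : F 0 = ⊤)
    (hF : ∀ a b, F a * F b ≤ F (a + b)) : Subring (Polynomial R) where
  carrier := {q | ∀ j, q.coeff j ∈ F j}
  mul_mem' {a b} ha hb j := by
    rw [Polynomial.coeff_mul]
    refine Ideal.sum_mem _ fun c hc => ?_
    rw [← Finset.HasAntidiagonal.mem_antidiagonal.mp hc]
    exact hF _ _ (Ideal.mul_mem_mul (ha _) (hb _))
  one_mem' j := by
    rw [Polynomial.coeff_one]
    split_ifs with h
    · rw [h, h0]
      trivial
    · exact zero_mem _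
  add_mem' ha hb j := by
    rw [Polynomial.coeff_add]
    exact add_mem (ha j) (hb j)
  zero_mem' j := by simp
  neg_mem' ha j := by
    rw [Polynomial.coeff_neg]
    exact neg_mem (ha j)

theorem monomial_mem_filtrationSubring {F : ℕ → Ideal R} (h0 : F 0 = ⊤)
    (hF : ∀ a b, F a * F b ≤ F (a + b)) (d : ℕ) (r : R) :
    Polynomial.X ^ d * Polynomial.C r ∈ filtrationSubring F h0 hF ↔ r ∈ F d := by
  rw [mul_comm, Polynomial.C_mul_X_pow_eq_monomial]
  constructor
  · intro h
    simpa using h d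
  · intro h j
    rw [Polynomial.coeff_monomial]
    split_ifs with hj
    · exact hj ▸ h
    · exact zero_mem _

theorem mem_range_map_subtype {A : Subring R} {x : WittVector p R} :
    x ∈ (map (p := p) A.subtype).range ↔ ∀ i, x.coeff i ∈ A := by
  constructor
  · rintro ⟨y, rfl⟩ i
    rw [map_coeff]
    exact (y.coeff i).2
  · intro h
    refine ⟨mk p fun i => ⟨x.coeff i, h i⟩, ?_⟩
    ext i
    rw [map_coeff, coeff_mk]
    rfl

variable {F : ℕ → Ideal R}

theorem teichmuller_X_mul_mem_iff (h0 : F 0 = ⊤) (hF : ∀ a b, F a * F b ≤ F (a + b))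
    (x : WittVector p R) :
    teichmuller p Polynomial.X * map Polynomial.C x ∈
        (map (p := p) (filtrationSubring F h0 hF).subtype).range ↔
      ∀ i, x.coeff i ∈ F (p ^ i) := by
  rw [mem_range_map_subtype]
  simp_rw [teichmuller_mul_coeff, map_coeff, monomial_mem_filtrationSubring]

theorem add_coeff_mem_filtration (h0 : F 0 = ⊤) (hF : ∀ a b, F a * F b ≤ F (a + b))
    {x y : WittVector p R} (hx : ∀ i, x.coeff i ∈ F (p ^ i))
    (hy : ∀ i, y.coeff i ∈ F (p ^ i)) (i : ℕ) : (x + y).coeff i ∈ F (p ^ i) := by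
  rw [← teichmuller_X_mul_mem_iff h0 hF] at hx hy
  revert i
  rw [← teichmuller_X_mul_mem_iff h0 hF, map_add, mul_add]
  exact add_mem hx hy

theorem mul_coeff_mem_filtration (h0 : F 0 = ⊤) (hF : ∀ a b, F a * F b ≤ F (a + b))
    (y : WittVector p R) {x : WittVector p R}
    (hx : ∀ i, x.coeff i ∈ F (p ^ i)) (i : ℕ) : (y * x).coeff i ∈ F (p ^ i) := by
  rw [← teichmuller_X_mul_mem_iff h0 hF] at hx
  revert i
  rw [← teichmuller_X_mul_mem_iff h0 hF, map_mul, mul_left_comm]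
  refine mul_mem (mem_range_map_subtype.mpr fun i => ?_) hx
  rw [map_coeff]
  have := (monomial_mem_filtrationSubring h0 hF 0 (y.coeff i)).mpr (by rw [h0]; trivial)
  simpa using this

theorem frobenius_coeff_mem_filtration (h0 : F 0 = ⊤) (hF : ∀ a b, F a * F b ≤ F (a + b))
    {x : WittVector p R}
    (hx : ∀ i, x.coeff i ∈ F (p ^ i)) (i : ℕ) :
    (frobenius x).coeff i ∈ F (p ^ (i + 1)) := by
  rw [← teichmuller_X_mul_mem_iff h0 hF] at hx
  obtain ⟨y, hy⟩ := hx
  have h : frobenius (teichmuller p Polynomial.X * map Polynomial.C x) ∈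
      (map (p := p) (filtrationSubring F h0 hF).subtype).range :=
    ⟨frobenius y, by rw [map_frobenius, hy]⟩
  rw [map_mul, frobenius_teichmuller, ← map_frobenius, mem_range_map_subtype] at h
  have := h i
  rwa [teichmuller_mul_coeff, map_coeff, ← pow_mul, ← pow_succ',
    monomial_mem_filtrationSubring] at this

end Filtration

section Ideals

variable {R : Type*} [CommRing R]

/-- The exponent `min (n + 1) ⌈j / (d + 1)⌉`. -/
def cutoffExponent (n d j : ℕ) : ℕ := min (n + 1) ((j + d) / (d + 1))

theorem cutoffExponent_add_le (n d a b : ℕ) :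
    cutoffExponent n d (a + b) ≤ cutoffExponent n d a + cutoffExponent n d b := by
  have h : (a + b + d) / (d + 1) ≤ (a + d) / (d + 1) + (b + d) / (d + 1) := by
    have ha := Nat.div_add_mod (a + d) (d + 1)
    have hb := Nat.div_add_mod (b + d) (d + 1)
    have ha' := Nat.mod_lt (a + d) (Nat.succ_pos d)
    have hb' := Nat.mod_lt (b + d) (Nat.succ_pos d)
    refine Nat.lt_succ_iff.mp ((Nat.div_lt_iff_lt_mul (Nat.succ_pos d)).mpr ?_)
    rw [Nat.succ_eq_add_one] at *
    nlinarith
  unfold cutoffExponent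
  generalize (a + b + d) / (d + 1) = u at *
  generalize (a + d) / (d + 1) = v at *
  generalize (b + d) / (d + 1) = w at *
  omega

theorem cutoffExponent_mono (n d : ℕ) {a b : ℕ} (hab : a ≤ b) :
    cutoffExponent n d a ≤ cutoffExponent n d b :=
  min_le_min le_rfl (Nat.div_le_div_right (by omega))

theorem cutoffExponent_anti (n j : ℕ) {d e : ℕ} (hde : d ≤ e) :
    cutoffExponent n e j ≤ cutoffExponent n d j := by
  refine min_le_min le_rfl ?_
  have h := Nat.div_add_mod (j + d) (d + 1)
  have h' := Nat.mod_lt (j + d) (Nat.succ_pos d)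
  refine Nat.lt_succ_iff.mp ((Nat.div_lt_iff_lt_mul (Nat.succ_pos e)).mpr ?_)
  rw [Nat.succ_eq_add_one] at *
  nlinarith

theorem cutoffExponent_zero (n d : ℕ) : cutoffExponent n d 0 = 0 := by
  simp [cutoffExponent]

theorem pow_cutoffExponent_zero (I : Ideal R) (n d : ℕ) : I ^ cutoffExponent n d 0 = ⊤ := by
  rw [cutoffExponent_zero, pow_zero, Ideal.one_eq_top]

theorem pow_cutoffExponent_mul_le (I : Ideal R) (n d a b : ℕ) :
    I ^ cutoffExponent n d a * I ^ cutoffExponent n d b ≤ I ^ cutoffExponent n d (a + b) := by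
  rw [← pow_add]
  exact Ideal.pow_le_pow_right (cutoffExponent_add_le n d a b)

/-- The ideal of Witt vectors with coefficients in `I`, almost all of which lie in `I ^ (n + 1)`. -/
def almostIdeal (p : ℕ) [Fact p.Prime] (I : Ideal R) (n : ℕ) : Ideal (WittVector p R) where
  carrier := {x | ∃ d, ∀ i, x.coeff i ∈ I ^ cutoffExponent n d (p ^ i)}
  zero_mem' := ⟨0, fun i => by simp⟩
  add_mem' := by
    rintro x y ⟨d, hx⟩ ⟨e, hy⟩
    exact ⟨max d e, add_coeff_mem_filtration (F := fun j => I ^ cutoffExponent n (max d e) j)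
      (pow_cutoffExponent_zero I n _) (pow_cutoffExponent_mul_le I n _)
      (fun i => Ideal.pow_le_pow_right (cutoffExponent_anti n _ (le_max_left d e)) (hx i))
      (fun i => Ideal.pow_le_pow_right (cutoffExponent_anti n _ (le_max_right d e)) (hy i))⟩
  smul_mem' := by
    rintro y x ⟨d, hx⟩
    exact ⟨d, mul_coeff_mem_filtration (F := fun j => I ^ cutoffExponent n d j)
      (pow_cutoffExponent_zero I n _) (pow_cutoffExponent_mul_le I n _) y hx⟩

theorem mem_almostIdeal {I : Ideal R} {n : ℕ} {x : WittVector p R} :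
    x ∈ almostIdeal p I n ↔
      (∀ i, x.coeff i ∈ I) ∧ ∀ᶠ i in Filter.atTop, x.coeff i ∈ I ^ (n + 1) := by
  constructor
  · rintro ⟨d, hx⟩
    refine ⟨fun i => Ideal.pow_le_self (?_ : cutoffExponent n d (p ^ i) ≠ 0) (hx i),
      Filter.eventually_atTop.mpr ⟨(n + 1) * (d + 1), fun i hi =>
        Ideal.pow_le_pow_right ?_ (hx i)⟩⟩
    · have hpos : 0 < p ^ i := pow_pos hp.1.pos i
      have : 0 < (p ^ i + d) / (d + 1) := Nat.div_pos (by omega) (Nat.succ_pos d)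
      unfold cutoffExponent
      omega
    · have hpi : i < p ^ i := Nat.lt_pow_self hp.1.one_lt
      refine le_min le_rfl ((Nat.le_div_iff_mul_le (Nat.succ_pos d)).mpr ?_)
      rw [Nat.succ_eq_add_one]
      omega
  · rintro ⟨hI, hx⟩
    obtain ⟨M, hM⟩ := Filter.eventually_atTop.mp hx
    refine ⟨p ^ M, fun i => ?_⟩
    rcases le_total M i with h | h
    · exact Ideal.pow_le_pow_right (min_le_left _ _) (hM i h)
    · have hle : cutoffExponent n (p ^ M) (p ^ i) ≤ 1 := by
        refine (min_le_right _ _).trans (Nat.lt_succ_iff.mp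
          ((Nat.div_lt_iff_lt_mul (Nat.succ_pos _)).mpr ?_))
        have := Nat.pow_le_pow_right hp.1.pos h
        rw [Nat.succ_eq_add_one]
        omega
      have := Ideal.pow_le_pow_right (I := I) hle
      rw [pow_one] at this
      exact this (hI i)

theorem frobenius_mem_almostIdeal {I : Ideal R} {n : ℕ} {x : WittVector p R}
    (hx : x ∈ almostIdeal p I n) : frobenius x ∈ almostIdeal p I n := by
  obtain ⟨d, hx⟩ := hx
  refine ⟨d, fun i => Ideal.pow_le_pow_right (cutoffExponent_mono n d
    (Nat.pow_le_pow_right hp.1.pos (Nat.le_succ i))) ?_⟩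
  exact frobenius_coeff_mem_filtration (F := fun j => I ^ cutoffExponent n d j)
      (pow_cutoffExponent_zero I n _) (pow_cutoffExponent_mul_le I n _) hx i

theorem mem_almostIdeal_of_coeff_mem {I : Ideal R} {n : ℕ} {x : WittVector p R}
    (hx : ∀ i, x.coeff i ∈ I ^ (n + 1)) : x ∈ almostIdeal p I n :=
  mem_almostIdeal.mpr
    ⟨fun i => Ideal.pow_le_self n.succ_ne_zero (hx i), Filter.Eventually.of_forall hx⟩

theorem memHatW_iff {R : Type} [CommRing R] {I : Ideal R} {x : WittVector p R} :
    MemHatW p I I x ↔ ∀ n, x ∈ almostIdeal p I n := by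
  simp_rw [mem_almostIdeal]
  constructor
  · rintro ⟨h, h'⟩ n
    exact ⟨h, h' (n + 1)⟩
  · intro h
    exact ⟨(h 0).1, fun n => (h n).2.mono fun i hi => Ideal.pow_le_pow_right n.le_succ hi⟩

theorem constantCoeff_frobeniusPolyAux (n : ℕ) :
    MvPolynomial.constantCoeff (frobeniusPolyAux p n) = 0 := by
  have h := coeff_frobenius (0 : WittVector p ℤ) n
  rw [map_zero, zero_coeff, show (0 : WittVector p ℤ).coeff = 0 from funext (zero_coeff p ℤ),
    frobeniusPoly] at h
  simpa [hp.1.ne_zero] using h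

theorem aeval_mem_of_constantCoeff_eq_zero {σ : Type*} {I : Ideal R} {q : MvPolynomial σ ℤ}
    (hq : MvPolynomial.constantCoeff q = 0) {x : σ → R} (hx : ∀ i, x i ∈ I) :
    MvPolynomial.aeval x q ∈ I := by
  rw [← Ideal.Quotient.eq_zero_iff_mem]
  have : ((Ideal.Quotient.mk I).comp (MvPolynomial.aeval x : MvPolynomial σ ℤ →ₐ[ℤ] R).toRingHom) =
      (Int.castRingHom (R ⧸ I)).comp MvPolynomial.constantCoeff := by
    apply MvPolynomial.ringHom_ext
    · intro r
      simp
    · intro i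
      simpa using Ideal.Quotient.eq_zero_iff_mem.mpr (hx i)
  have h := RingHom.congr_fun this q
  simpa [hq] using h

theorem frobenius_coeff_mem_mul {I J : Ideal R} (hp' : (p : R) ∈ J) (hIJ : I ≤ J)
    {x : WittVector p R} (hx : ∀ i, x.coeff i ∈ I) (i : ℕ) : (frobenius x).coeff i ∈ J * I := by
  rw [coeff_frobenius, frobeniusPoly, map_add, map_mul, map_pow, MvPolynomial.aeval_X,
    MvPolynomial.aeval_C]
  refine add_mem ?_ ?_
  · have : x.coeff i ^ p ∈ I ^ p := Ideal.pow_mem_pow (hx i) p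
    have h2 : I ^ p ≤ J * I :=
      (Ideal.pow_le_pow_right hp.1.two_le).trans (by rw [pow_two]; exact Ideal.mul_mono_left hIJ)
    exact h2 this
  · refine Ideal.mul_mem_mul (by simpa using hp') ?_
    exact aeval_mem_of_constantCoeff_eq_zero (constantCoeff_frobeniusPolyAux i) hx

theorem iterate_frobenius_coeff_mem {I : Ideal R} (hp' : (p : R) ∈ I) {x : WittVector p R}
    (hx : ∀ i, x.coeff i ∈ I) (n i : ℕ) : ((frobenius ^ n) x).coeff i ∈ I ^ (n + 1) := by
  induction n generalizing i with
  | zero => simpa using hx i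
  | succ n ih =>
    rw [pow_succ' I (n + 1), pow_succ' frobenius n]
    exact frobenius_coeff_mem_mul hp' (Ideal.pow_le_self n.succ_ne_zero) ih i

theorem iterate_frobenius_mem {T : Subring (WittVector p R)} (hT : ∀ x ∈ T, frobenius x ∈ T)
    {x : WittVector p R} (hx : x ∈ T) (n : ℕ) : (frobenius ^ n) x ∈ T := by
  induction n with
  | zero => exact hx
  | succ n ih =>
    rw [pow_succ']
    exact hT _ ih

theorem map_iterate_frobenius {S : Type*} [CommRing S] (f : R →+* S) (x : WittVector p R)
    (n : ℕ) : map f ((frobenius ^ n) x) = (frobenius ^ n) (map f x) := by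
  induction n with
  | zero => rfl
  | succ n ih =>
    rw [pow_succ', pow_succ']
    exact (map_frobenius f _).trans (congrArg _ ih)

theorem iterate_frobenius_bijective (k : Type*) [CommRing k] [CharP k p] [PerfectRing k p]
    (n : ℕ) : Function.Bijective (frobenius ^ n : WittVector p k →+* WittVector p k) := by
  induction n with
  | zero => exact Function.bijective_id
  | succ n ih =>
    rw [pow_succ']
    exact (frobenius_bijective p k).comp ih

/-- The subring of Witt vectors that are `n`-fold Frobenius images up to `almostIdeal p I n`,
for every `n`. -/
noncomputable def specialSubring (p : ℕ) [Fact p.Prime] (I : Ideal R) : Subring (WittVector p R) :=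
  ⨅ n : ℕ, ((frobenius ^ n : WittVector p R →+* WittVector p R).range.map
    (Ideal.Quotient.mk (almostIdeal p I n))).comap (Ideal.Quotient.mk (almostIdeal p I n))

theorem mem_specialSubring {I : Ideal R} {x : WittVector p R} :
    x ∈ specialSubring p I ↔ ∀ n, ∃ z, x - (frobenius ^ n) z ∈ almostIdeal p I n := by
  simp only [specialSubring, Subring.mem_iInf, Subring.mem_comap, Subring.mem_map,
    RingHom.mem_range, exists_exists_eq_and]
  refine forall_congr' fun n => exists_congr fun z => ?_
  rw [eq_comm, Ideal.Quotient.eq]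

theorem frobenius_mem_specialSubring {I : Ideal R} {x : WittVector p R}
    (hx : x ∈ specialSubring p I) : frobenius x ∈ specialSubring p I := by
  rw [mem_specialSubring] at *
  intro n
  obtain ⟨z, hz⟩ := hx n
  refine ⟨frobenius z, ?_⟩
  have h : (frobenius ^ n) (frobenius z) = frobenius ((frobenius ^ n) z) := by
    have := congrArg (fun g : WittVector p R →+* WittVector p R => g z)
      ((pow_succ (frobenius : WittVector p R →+* WittVector p R) n).symm.trans (pow_succ' _ n))
    exact this
  rw [h, ← map_sub]
  exact frobenius_mem_almostIdeal hz

theorem map_eq_zero_iff_coeff_mem_ker {S : Type*} [CommRing S] {f : R →+* S}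
    {x : WittVector p R} : map f x = 0 ↔ ∀ i, x.coeff i ∈ RingHom.ker f := by
  simp [map_eq_zero_iff, RingHom.mem_ker]

theorem sub_coeff_mem_of_coeff_sub_mem {I : Ideal R} {x y : WittVector p R} :
    (∀ i, (x - y).coeff i ∈ I) ↔ ∀ i, x.coeff i - y.coeff i ∈ I := by
  have h := map_eq_zero_iff_coeff_mem_ker (p := p) (f := Ideal.Quotient.mk I) (x := x - y)
  rw [Ideal.mk_ker, map_sub, sub_eq_zero] at h
  rw [← h, WittVector.ext_iff]
  simp only [map_coeff, Ideal.Quotient.eq]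

theorem exists_limit {I : Ideal R} [IsPrecomplete I R] (x : ℕ → WittVector p R)
    (hx : ∀ n i, (x (n + 1) - x n).coeff i ∈ I ^ n) :
    ∃ y : WittVector p R, ∀ n i, (x n - y).coeff i ∈ I ^ n := by
  have hx' : ∀ n i, (x (n + 1)).coeff i - (x n).coeff i ∈ I ^ n := fun n =>
    sub_coeff_mem_of_coeff_sub_mem.mp (hx n)
  have hc : ∀ i, ∃ L : R, ∀ n, (x n).coeff i ≡ L [SMOD (I ^ n • ⊤ : Submodule R R)] := by
    intro i
    refine IsPrecomplete.prec' _ fun {m n} hmn => ?_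
    induction n, hmn using Nat.le_induction with
    | base => rfl
    | succ n hmn ih =>
      refine ih.trans (SModEq.symm ?_)
      rw [SModEq.sub_mem, smul_eq_mul, Ideal.mul_top]
      exact Ideal.pow_le_pow_right hmn (hx' n i)
  choose L hL using hc
  refine ⟨mk p L, fun n => sub_coeff_mem_of_coeff_sub_mem.mpr fun i => ?_⟩
  have := hL i n
  rwa [SModEq.sub_mem, smul_eq_mul, Ideal.mul_top] at this

end Ideals

theorem natCast_mem_of_ker_eq {p : ℕ} {R k : Type*} [CommRing R] [CommRing k] [CharP k p]
    {I : Ideal R} {ρ : R →+* k} (hker : RingHom.ker ρ = I) : (p : R) ∈ I := by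
  rw [← hker, RingHom.mem_ker, map_natCast, CharP.cast_eq_zero]

section Special

variable {R k : Type} [CommRing R] [CommRing k] [CharP k p] [PerfectRing k p]
  {I : Ideal R} {ρ : R →+* k}

theorem exists_mem_specialSubring_map_eq [IsPrecomplete I R] (hρ : Function.Surjective ρ)
    (hker : RingHom.ker ρ = I) (y : WittVector p k) :
    ∃ x ∈ specialSubring p I, map ρ x = y := by
  choose t ht using fun n => (iterate_frobenius_bijective (p := p) k n).surjective y
  choose z hz using fun n => map_surjective (p := p) ρ hρ (t n)
  have hfz : ∀ n, (frobenius ^ (n + 1)) (z (n + 1)) - (frobenius ^ n) (z n) =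
      (frobenius ^ n) (frobenius (z (n + 1)) - z n) := by
    intro n
    rw [map_sub, pow_succ]
    rfl
  have hker' : ∀ n i, (frobenius (z (n + 1)) - z n).coeff i ∈ I := by
    intro n
    rw [← hker, ← map_eq_zero_iff_coeff_mem_ker, map_sub, map_frobenius, hz, hz, sub_eq_zero]
    apply (iterate_frobenius_bijective (p := p) k n).injective
    rw [ht, ← ht (n + 1), pow_succ]
    rfl
  have hp' := natCast_mem_of_ker_eq (p := p) hker
  have hstep : ∀ n i, ((frobenius ^ (n + 1)) (z (n + 1)) - (frobenius ^ n) (z n)).coeff i ∈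
      I ^ (n + 1) := by
    intro n
    rw [hfz]
    exact iterate_frobenius_coeff_mem hp' (hker' n) n
  obtain ⟨x, hx⟩ := exists_limit (I := I) (fun n => (frobenius ^ n) (z n))
    fun n i => Ideal.pow_le_pow_right n.le_succ (hstep n i)
  refine ⟨x, mem_specialSubring.mpr fun n => ⟨frobenius (z (n + 1)), ?_⟩, ?_⟩
  · have h := mem_almostIdeal_of_coeff_mem (hx (n + 1))
    rw [pow_succ] at h
    have h' := neg_mem h
    rwa [neg_sub] at h'
  · have h := hx 1
    rw [pow_one I, ← hker, ← map_eq_zero_iff_coeff_mem_ker, map_sub, map_iterate_frobenius, hz,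
      ht, sub_eq_zero] at h
    exact h.symm

theorem mem_specialSubring_and_map_eq_zero_iff (hker : RingHom.ker ρ = I) (x : WittVector p R) :
    (x ∈ specialSubring p I ∧ map ρ x = 0) ↔ MemHatW p I I x := by
  rw [memHatW_iff]
  constructor
  · rintro ⟨hx, hx0⟩ n
    obtain ⟨z, hz⟩ := mem_specialSubring.mp hx n
    have hz0 : map ρ z = 0 := by
      apply (iterate_frobenius_bijective (p := p) k n).injective
      have h := (mem_almostIdeal.mp hz).1
      rw [← hker, ← map_eq_zero_iff_coeff_mem_ker, map_sub, hx0, zero_sub, neg_eq_zero,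
        map_iterate_frobenius] at h
      rw [h, map_zero]
    rw [map_eq_zero_iff_coeff_mem_ker, hker] at hz0
    have h := mem_almostIdeal_of_coeff_mem
      (iterate_frobenius_coeff_mem (natCast_mem_of_ker_eq (p := p) hker) hz0 n)
    simpa using add_mem hz h
  · intro hx
    refine ⟨mem_specialSubring.mpr fun n => ⟨0, by simpa using hx n⟩, ?_⟩
    rw [map_eq_zero_iff_coeff_mem_ker, hker]
    exact (mem_almostIdeal.mp (hx 0)).1

theorem eq_specialSubring (hker : RingHom.ker ρ = I) {T : Subring (WittVector p R)}
    (hT : IsSpecialSubring p I ρ T) : T = specialSubring p I := by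
  obtain ⟨hfrob, hsurj, hTker⟩ := hT
  have hle : T ≤ specialSubring p I := by
    intro x hx
    rw [mem_specialSubring]
    intro n
    obtain ⟨t, ht⟩ := (iterate_frobenius_bijective (p := p) k n).surjective (map ρ x)
    obtain ⟨z, hzT, hz⟩ := hsurj t
    refine ⟨z, memHatW_iff.mp ((hTker _).mp
      ⟨sub_mem hx (iterate_frobenius_mem hfrob hzT n), ?_⟩) n⟩
    rw [map_sub, map_iterate_frobenius, hz, ht, sub_self]
  refine le_antisymm hle fun x hx => ?_
  obtain ⟨x', hx'T, hx'⟩ := hsurj (map ρ x)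
  have h := (mem_specialSubring_and_map_eq_zero_iff hker (x - x')).mp
    ⟨sub_mem hx (hle hx'T), by rw [map_sub, hx', sub_self]⟩
  simpa using add_mem ((hTker _).mpr h).1 hx'T

end Special

end WittVector

/-- For a noetherian complete local ring `R` with perfect residue field
`k` of characteristic `p`, there is a unique Frobenius-stable subring `𝕎(R) ⊆ W(R)`
mapping surjectively onto `W(k)` with kernel `Ŵ(𝔪)`. -/
theorem exists_unique_special_subring (p : ℕ) [Fact p.Prime]
    (R : Type) [CommRing R] [IsLocalRing R] [IsNoetherianRing R]
    [IsAdicComplete (IsLocalRing.maximalIdeal R) R]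
    (k : Type) [Field k] [CharP k p] [PerfectRing k p]
    (ρ : R →+* k) (hρ : Function.Surjective ρ)
    (hker : RingHom.ker ρ = IsLocalRing.maximalIdeal R) :
    ∃! T : Subring (WittVector p R),
      IsSpecialSubring p (IsLocalRing.maximalIdeal R) ρ T := by
  refine ⟨WittVector.specialSubring p (IsLocalRing.maximalIdeal R),
    ⟨fun _ => WittVector.frobenius_mem_specialSubring,
      WittVector.exists_mem_specialSubring_map_eq hρ hker,
      WittVector.mem_specialSubring_and_map_eq_zero_iff hker⟩,
    fun _ => WittVector.eq_specialSubring hker⟩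
end

section
/- Let p be a prime with p ≥ 3 and let R be a noetherian complete local ring with maximal ideal 𝔪 and perfect residue field k of characteristic p. Then 𝕎(R) is a local ring, stable under the Frobenius f and the Verschiebung v of W(R), and 𝓕_R = (𝕎(R), 𝕀_R, R, f, f₁) is a frame, where 𝕀_R = ker(𝕎(R) → R) = v(𝕎(R)) ∩ 𝕎(R) and f₁ = v⁻¹ : 𝕀_R → 𝕎(R); moreover its element π (characterized by f(x) = π·f₁(x) for x ∈ 𝕀_R) equals p. -/
open scoped BigOperators

namespace WittVector

variable {p : ℕ} [hp : Fact p.Prime]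

theorem isNilpotent_verschiebung {A : Type*} [CommRing A] {x : WittVector p A}
    (hx : IsNilpotent x) : IsNilpotent (verschiebung x) := by
  obtain ⟨r, hr⟩ := hx
  have key : ∀ n : ℕ,
      verschiebung x ^ (n + 1) = (p : WittVector p A) ^ n * verschiebung (x ^ (n + 1)) := by
    intro n
    induction n with
    | zero => simp
    | succ n ih =>
      have h : verschiebung (x ^ (n + 1)) * verschiebung x
          = p * verschiebung (x ^ (n + 2)) := by
        rw [← verschiebung_mul_frobenius, frobenius_verschiebung, ← mul_assoc, ← pow_succ,
          ← nsmul_eq_mul', ← nsmul_eq_mul, map_nsmul]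
      rw [pow_succ, ih, mul_assoc, h]
      ring
  exact ⟨r + 1, by rw [key, pow_succ, hr]; simp⟩

theorem eq_teichmuller_add_verschiebung {A : Type*} [CommRing A] (x : WittVector p A) :
    x = teichmuller p (x.coeff 0) + verschiebung (x.shift 1) := by
  ext n
  rw [coeff_add_of_disjoint]
  · cases n with
    | zero => simp
    | succ n => simp [verschiebung_coeff_succ, shift_coeff, add_comm]
  · intro n
    cases n with
    | zero => right; simp
    | succ n => left; simp

/-- A Witt vector with finitely many nonzero coefficients, all of them nilpotent, is nilpotent. -/
theorem isNilpotent_of_coeff {A : Type*} [CommRing A] {x : WittVector p A} (M : ℕ)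
    (hM : ∀ i, M ≤ i → x.coeff i = 0) (hx : ∀ i, IsNilpotent (x.coeff i)) : IsNilpotent x := by
  induction M generalizing x with
  | zero =>
    have : x = 0 := by ext i; simpa using hM i (Nat.zero_le i)
    exact this ▸ IsNilpotent.zero
  | succ M ih =>
    have h₁ : IsNilpotent (x.shift 1) :=
      ih (fun i hi ↦ by rw [shift_coeff]; exact hM _ (by omega))
        (fun i ↦ by rw [shift_coeff]; exact hx _)
    have h₂ : IsNilpotent (teichmuller p (x.coeff 0)) := by
      obtain ⟨r, hr⟩ := hx 0
      exact ⟨r + 1, by rw [← map_pow, pow_succ, hr]; simp⟩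
    rw [eq_teichmuller_add_verschiebung x]
    exact (Commute.all _ _).isNilpotent_add h₂ (isNilpotent_verschiebung h₁)

theorem map_quotientMk_eq_iff {R : Type*} [CommRing R] {I : Ideal R} {x y : WittVector p R} :
    map (Ideal.Quotient.mk I) x = map (Ideal.Quotient.mk I) y ↔
      ∀ i, x.coeff i - y.coeff i ∈ I := by
  simp [WittVector.ext_iff, map_coeff, Ideal.Quotient.mk_eq_mk_iff_sub_mem]

theorem pow_succ_dvd_coeff_of_pow_dvd_ghostComponent (hp3 : 3 ≤ p) {x : WittVector p ℤ}
    (hx : ∀ n, (p : ℤ) ^ (2 * n + 1) ∣ ghostComponent n x) (n : ℕ) :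
    (p : ℤ) ^ (n + 1) ∣ x.coeff n := by
  induction n using Nat.strong_induction_on with
  | _ n ih =>
    have h := hx n
    rw [ghostComponent_apply, aeval_wittPolynomial, Finset.sum_range_succ] at h
    have hsum : (p : ℤ) ^ (2 * n + 1) ∣
        ∑ i ∈ Finset.range n, (p : ℤ) ^ i * x.coeff i ^ p ^ (n - i) := by
      refine Finset.dvd_sum fun i hi ↦ ?_
      obtain ⟨d, rfl⟩ := Nat.exists_eq_add_of_lt (Finset.mem_range.mp hi)
      have hpow : 2 * (d + 1) + 1 ≤ p ^ (d + 1) := by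
        refine le_trans ?_ (Nat.pow_le_pow_left hp3 (d + 1))
        clear * -
        induction d with
        | zero => norm_num
        | succ d ih => rw [pow_succ]; omega
      have h₁ : i + d + 1 - i = d + 1 := by omega
      rw [h₁]
      refine dvd_trans ?_ (mul_dvd_mul_left _ (pow_dvd_pow_of_dvd (ih i (by omega)) _))
      rw [← pow_mul, ← pow_add]
      exact pow_dvd_pow _ (by nlinarith)
    have h₂ := (dvd_add_right hsum).mp h
    rw [Nat.sub_self, pow_zero, pow_one, show 2 * n + 1 = n + (n + 1) by ring, pow_add] at h₂
    exact Int.dvd_of_mul_dvd_mul_left (pow_ne_zero _ (by exact_mod_cast hp.out.ne_zero)) h₂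

theorem pow_succ_dvd_coeff_verschiebung_one_sub_p (hp3 : 3 ≤ p) (n : ℕ) :
    (p : ℤ) ^ (n + 1) ∣ (verschiebung (1 : WittVector p ℤ) - p).coeff n := by
  refine pow_succ_dvd_coeff_of_pow_dvd_ghostComponent hp3 (fun n ↦ ?_) n
  cases n with
  | zero => simp [ghostComponent_zero_verschiebung]
  | succ n => simp [ghostComponent_verschiebung]

end WittVector

open WittVector

section HatW

variable {p : ℕ} [hp : Fact p.Prime] {R : Type} [CommRing R] {𝔪 : Ideal R}

theorem MemHatW.verschiebung {x : WittVector p R} (hx : MemHatW p 𝔪 𝔪 x) :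
    MemHatW p 𝔪 𝔪 (verschiebung x) := by
  refine ⟨fun i ↦ ?_, fun n ↦ ?_⟩
  · cases i with
    | zero => simp
    | succ i => exact hx.1 i
  · obtain ⟨M, hM⟩ := Filter.eventually_atTop.mp (hx.2 n)
    refine Filter.eventually_atTop.mpr ⟨M + 1, fun i hi ↦ ?_⟩
    obtain ⟨i, rfl⟩ : ∃ j, i = j + 1 := ⟨i - 1, by omega⟩
    exact hM i (by omega)

theorem MemHatW.of_verschiebung {x : WittVector p R}
    (hx : MemHatW p 𝔪 𝔪 (WittVector.verschiebung x)) : MemHatW p 𝔪 𝔪 x := by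
  refine ⟨fun i ↦ hx.1 (i + 1), fun n ↦ ?_⟩
  obtain ⟨M, hM⟩ := Filter.eventually_atTop.mp (hx.2 n)
  exact Filter.eventually_atTop.mpr ⟨M, fun i hi ↦ hM (i + 1) (by omega)⟩

theorem MemHatW.of_forall_map_eq {x : WittVector p R}
    (h : ∀ n, ∃ y, MemHatW p 𝔪 𝔪 y ∧
      WittVector.map (Ideal.Quotient.mk (𝔪 ^ n)) x = WittVector.map (Ideal.Quotient.mk (𝔪 ^ n)) y) :
    MemHatW p 𝔪 𝔪 x := by
  refine ⟨fun i ↦ ?_, fun n ↦ ?_⟩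
  · obtain ⟨y, hy, hxy⟩ := h 1
    have := map_quotientMk_eq_iff.mp hxy i
    rw [pow_one] at this
    simpa using add_mem this (hy.1 i)
  · obtain ⟨y, hy, hxy⟩ := h n
    filter_upwards [hy.2 n] with i hi
    simpa using add_mem (map_quotientMk_eq_iff.mp hxy i) hi

theorem MemHatW.isNilpotent_map {x : WittVector p R} (hx : MemHatW p 𝔪 𝔪 x) (n : ℕ) :
    IsNilpotent (WittVector.map (Ideal.Quotient.mk (𝔪 ^ n)) x) := by
  obtain ⟨M, hM⟩ := Filter.eventually_atTop.mp (hx.2 n)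
  refine isNilpotent_of_coeff M (fun i hi ↦ ?_) (fun i ↦ ⟨n, ?_⟩)
  · rw [map_coeff, Ideal.Quotient.eq_zero_iff_mem]
    exact hM i hi
  · rw [map_coeff, ← map_pow, Ideal.Quotient.eq_zero_iff_mem]
    exact Ideal.pow_mem_pow (hx.1 i) n

theorem memHatW_verschiebung_one_sub_p (hp3 : 3 ≤ p) (hpm : (p : R) ∈ 𝔪) :
    MemHatW p 𝔪 𝔪 (WittVector.verschiebung (1 : WittVector p R) - (p : WittVector p R)) := by
  have key (i : ℕ) : (WittVector.verschiebung (1 : WittVector p R) - (p : WittVector p R)).coeff i ∈ 𝔪 ^ (i + 1) := by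
    have h : WittVector.verschiebung (1 : WittVector p R) - (p : WittVector p R) =
        WittVector.map (Int.castRingHom R)
          (WittVector.verschiebung (1 : WittVector p ℤ) - (p : WittVector p ℤ)) := by
      simp [map_verschiebung]
    obtain ⟨c, hc⟩ := pow_succ_dvd_coeff_verschiebung_one_sub_p (p := p) hp3 i
    rw [h, map_coeff, hc]
    simpa using Ideal.mul_mem_right _ _ (Ideal.pow_mem_pow hpm (i + 1))
  refine ⟨fun i ↦ Ideal.pow_le_self (Nat.succ_ne_zero i) (key i), fun n ↦ ?_⟩
  exact Filter.eventually_atTop.mpr ⟨n, fun i hi ↦ Ideal.pow_le_pow_right (by omega) (key i)⟩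

/-- Witt vectors over a complete ring can be glued from a family that is compatible modulo
the powers of the ideal. -/
theorem exists_forall_map_quotientMk_eq [IsPrecomplete 𝔪 R] (y : ℕ → WittVector p R)
    (hy : ∀ m n, m ≤ n → WittVector.map (Ideal.Quotient.mk (𝔪 ^ m)) (y m) =
      WittVector.map (Ideal.Quotient.mk (𝔪 ^ m)) (y n)) :
    ∃ u : WittVector p R, ∀ n, WittVector.map (Ideal.Quotient.mk (𝔪 ^ n)) u =
      WittVector.map (Ideal.Quotient.mk (𝔪 ^ n)) (y n) := by
  have h (i : ℕ) : ∃ L : R, ∀ n, (y n).coeff i - L ∈ 𝔪 ^ n := by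
    obtain ⟨L, hL⟩ := IsPrecomplete.prec (I := 𝔪) (M := R) inferInstance
      (f := fun n ↦ (y n).coeff i) (fun {m n} hmn ↦ by
        rw [SModEq.sub_mem, smul_eq_mul, Ideal.mul_top]
        exact map_quotientMk_eq_iff.mp (hy m n hmn) i)
    refine ⟨L, fun n ↦ ?_⟩
    simpa [SModEq.sub_mem] using hL n
  choose L hL using h
  exact ⟨WittVector.mk p L, fun n ↦ Eq.symm (map_quotientMk_eq_iff.mpr fun i ↦ hL i n)⟩

theorem eq_of_forall_map_quotientMk_eq [IsHausdorff 𝔪 R] {x y : WittVector p R}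
    (h : ∀ n, WittVector.map (Ideal.Quotient.mk (𝔪 ^ n)) x =
      WittVector.map (Ideal.Quotient.mk (𝔪 ^ n)) y) : x = y := by
  ext i
  refine (IsHausdorff.eq_iff_smodEq (I := 𝔪)).mpr fun n ↦ ?_
  rw [SModEq.sub_mem, smul_eq_mul, Ideal.mul_top]
  exact map_quotientMk_eq_iff.mp (h n) i

namespace IsSpecialSubring

variable {k : Type} [CommRing k] {ρ : R →+* k} {T : Subring (WittVector p R)}

theorem mem_of_memHatW (hT : IsSpecialSubring p 𝔪 ρ T) {x : WittVector p R}
    (hx : MemHatW p 𝔪 𝔪 x) : x ∈ T :=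
  ((hT.2.2 x).mpr hx).1

theorem exists_mul_eq_one [IsAdicComplete 𝔪 R] (hT : IsSpecialSubring p 𝔪 ρ T)
    {x : WittVector p R} (hx : MemHatW p 𝔪 𝔪 x) : ∃ u ∈ T, (1 + x) * u = 1 := by
  obtain ⟨hxT, hx0⟩ := (hT.2.2 x).mpr hx
  have hinv (n : ℕ) : ∃ y, MemHatW p 𝔪 𝔪 (y - 1) ∧
      WittVector.map (Ideal.Quotient.mk (𝔪 ^ n)) ((1 + x) * y) = 1 := by
    obtain ⟨r, hr⟩ := hx.isNilpotent_map n
    refine ⟨∑ i ∈ Finset.range (r + 1), (-x) ^ i, ?_, ?_⟩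
    · refine (hT.2.2 _).mp ⟨sub_mem (sum_mem fun i _ ↦ pow_mem (neg_mem hxT) i) (one_mem T), ?_⟩
      simp [Finset.sum_range_succ', hx0]
    · have h := mul_neg_geom_sum (-x) (r + 1)
      rw [sub_neg_eq_add] at h
      rw [h, map_sub, map_one, map_pow, map_neg, neg_pow, pow_succ (WittVector.map _ x), hr]
      simp
  choose y hy₁ hy₂ using hinv
  obtain ⟨u, hu⟩ := exists_forall_map_quotientMk_eq (𝔪 := 𝔪) y fun m n hmn ↦ by
    have h : WittVector.map (Ideal.Quotient.mk (𝔪 ^ m)) ((1 + x) * y n) = 1 := by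
      have h₁ := hy₂ n
      rw [← map_one (WittVector.map (Ideal.Quotient.mk (𝔪 ^ n))), map_quotientMk_eq_iff] at h₁
      rw [← map_one (WittVector.map (Ideal.Quotient.mk (𝔪 ^ m))), map_quotientMk_eq_iff]
      exact fun i ↦ Ideal.pow_le_pow_right hmn (h₁ i)
    have h₂ := hy₂ m
    rw [map_mul] at h h₂
    exact left_inv_eq_right_inv (by rw [mul_comm, h₂]) h
  refine ⟨u, ?_, eq_of_forall_map_quotientMk_eq (𝔪 := 𝔪) fun n ↦ ?_⟩
  · have h : MemHatW p 𝔪 𝔪 (u - 1) := .of_forall_map_eq fun n ↦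
      ⟨y n - 1, hy₁ n, by rw [map_sub, hu, map_sub]⟩
    simpa using add_mem (hT.mem_of_memHatW h) (one_mem T)
  · rw [map_mul, hu, ← map_mul, hy₂, map_one]

theorem isUnit_of_isUnit_map [IsAdicComplete 𝔪 R] (hT : IsSpecialSubring p 𝔪 ρ T) (x : T)
    (hx : IsUnit (WittVector.map ρ (x : WittVector p R))) : IsUnit x := by
  obtain ⟨z, hz⟩ := hx.exists_right_inv
  obtain ⟨y, hyT, rfl⟩ := hT.2.1 z
  have h : MemHatW p 𝔪 𝔪 (x * y - 1) :=
    (hT.2.2 _).mp ⟨sub_mem (mul_mem x.2 hyT) (one_mem T), by simp [hz]⟩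
  obtain ⟨u, huT, hu⟩ := hT.exists_mul_eq_one h
  refine IsUnit.of_mul_eq_one (⟨y * u, mul_mem hyT huT⟩ : T) (Subtype.ext ?_)
  simpa [mul_assoc] using hu

theorem verschiebung_mem [CharP k p] [PerfectRing k p] (hT : IsSpecialSubring p 𝔪 ρ T)
    (hp3 : 3 ≤ p) (hpm : (p : R) ∈ 𝔪) {x : WittVector p R} (hx : x ∈ T) :
    verschiebung x ∈ T := by
  have h1 : verschiebung (1 : WittVector p R) ∈ T := by
    simpa using add_mem (hT.mem_of_memHatW (memHatW_verschiebung_one_sub_p hp3 hpm))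
      (natCast_mem T p)
  obtain ⟨z, hz⟩ := (frobenius_bijective p k).surjective (WittVector.map ρ x)
  obtain ⟨y, hyT, rfl⟩ := hT.2.1 z
  have h : MemHatW p 𝔪 𝔪 (x - frobenius y) := by
    refine (hT.2.2 _).mp ⟨sub_mem hx (hT.1 y hyT), ?_⟩
    have hmap : WittVector.map ρ (frobenius y) = frobenius (WittVector.map ρ y) :=
      frobenius_isPoly p |>.map ρ y
    rw [map_sub, hmap, hz, sub_self]
  have hy : verschiebung (frobenius y) = verschiebung 1 * y := by
    rw [← verschiebung_mul_frobenius, one_mul]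
  have := add_mem (hT.mem_of_memHatW h.verschiebung) (mul_mem h1 hyT)
  rwa [← hy, ← map_add, sub_add_cancel] at this

theorem mem_of_verschiebung_mem [CharP k p] [PerfectRing k p] (hT : IsSpecialSubring p 𝔪 ρ T)
    (hp3 : 3 ≤ p) (hpm : (p : R) ∈ 𝔪) {x : WittVector p R} (hx : verschiebung x ∈ T) :
    x ∈ T := by
  obtain ⟨y, hyT, hy⟩ := hT.2.1 (WittVector.map ρ x)
  have h : MemHatW p 𝔪 𝔪 (verschiebung (x - y)) := by
    refine (hT.2.2 _).mp ⟨?_, ?_⟩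
    · rw [map_sub]
      exact sub_mem hx (hT.verschiebung_mem hp3 hpm hyT)
    · rw [map_verschiebung, map_sub, hy, sub_self, map_zero]
  simpa using add_mem (hT.mem_of_memHatW h.of_verschiebung) hyT

theorem isLocalRing {k : Type} [Field k] [CharP k p] {ρ : R →+* k} [IsAdicComplete 𝔪 R]
    (hT : IsSpecialSubring p 𝔪 ρ T) : IsLocalRing T := by
  let g : T →+* k := (constantCoeff.comp (WittVector.map ρ)).comp T.subtype
  have : IsLocalHom g := ⟨fun x hx ↦
    hT.isUnit_of_isUnit_map x (isUnit_of_coeff_zero_ne_zero _ hx.ne_zero)⟩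
  exact g.domain_isLocalRing

end IsSpecialSubring

end HatW

theorem exists_verschiebung_eq_iff {p : ℕ} [Fact p.Prime] {R : Type*} [CommRing R]
    {x : WittVector p R} : (∃ y, verschiebung y = x) ↔ x.coeff 0 = 0 := by
  refine ⟨?_, fun h ↦ ⟨x.shift 1, ?_⟩⟩
  · rintro ⟨y, rfl⟩
    simp
  · have := eq_teichmuller_add_verschiebung x
    rw [h, teichmuller_zero, zero_add] at this
    exact this.symm


open WittVector in
/-- For `p ≥ 3` and `R` noetherian complete local with perfect residue
field `k` of characteristic `p`, the ring `𝕎(R)` is local and stable under `f` and `v`,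
and `𝓕_R = (𝕎(R), 𝕀_R, R, f, f₁ = v⁻¹)` is a frame with `π = p`, where
`𝕀_R = ker(𝕎(R) → R) = v(W(R)) ∩ 𝕎(R)`. -/
theorem dieudonne_frame_exists (p : ℕ) [Fact p.Prime] (hp3 : 3 ≤ p)
    (R : Type) [CommRing R] [IsLocalRing R] [IsNoetherianRing R]
    [IsAdicComplete (IsLocalRing.maximalIdeal R) R]
    (k : Type) [Field k] [CharP k p] [PerfectRing k p]
    (ρ : R →+* k) (hρ : Function.Surjective ρ)
    (hker : RingHom.ker ρ = IsLocalRing.maximalIdeal R)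
    (T : Subring (WittVector p R))
    (hT : IsSpecialSubring p (IsLocalRing.maximalIdeal R) ρ T) :
    IsLocalRing T ∧
    (∀ x ∈ T, frobenius x ∈ T) ∧
    (∀ x ∈ T, verschiebung x ∈ T) ∧
    ∃ 𝓕 : Frame T,
      (∀ x : T, x ∈ 𝓕.I ↔ (x : WittVector p R).coeff 0 = 0) ∧
      (∀ x : T, x ∈ 𝓕.I ↔ ∃ y : WittVector p R,
          verschiebung y = (x : WittVector p R)) ∧
      (∀ x : T, ((𝓕.f x : T) : WittVector p R) = frobenius (x : WittVector p R)) ∧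
      (∀ x : 𝓕.I, verschiebung (((𝓕.f₁ x : T)) : WittVector p R)
          = ((x : T) : WittVector p R)) ∧
      (∀ x : 𝓕.I, 𝓕.f (x : T) = (p : T) * 𝓕.f₁ x) := by
  have hpm : (p : R) ∈ IsLocalRing.maximalIdeal R := by
    rw [← hker, RingHom.mem_ker, map_natCast, CharP.cast_eq_zero]
  have hlocal : IsLocalRing T := hT.isLocalRing
  refine ⟨hlocal, hT.1, fun x hx ↦ hT.verschiebung_mem hp3 hpm hx, ?_⟩
  let I : Ideal T := RingHom.ker (constantCoeff.comp T.subtype)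
  have hI (x : T) : x ∈ I ↔ (x : WittVector p R).coeff 0 = 0 := Iff.rfl
  have hI' (x : T) : x ∈ I ↔ ∃ y : WittVector p R, verschiebung y = (x : WittVector p R) :=
    (hI x).trans exists_verschiebung_eq_iff.symm
  let f : T →+* T := frobenius.restrict T T hT.1
  have hex (x : I) : ∃ y : T, verschiebung (y : WittVector p R) = ((x : T) : WittVector p R) := by
    obtain ⟨y, hy⟩ := (hI' x).mp x.2
    exact ⟨⟨y, hT.mem_of_verschiebung_mem hp3 hpm (hy ▸ x.1.2)⟩, hy⟩
  choose g hg using hex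
  have hinj {a b : T} (h : verschiebung (a : WittVector p R) = verschiebung (b : WittVector p R)) :
      a = b := Subtype.ext (verschiebung_injective p R h)
  let f₁ : I →ₛₗ[f] T :=
    { toFun := g
      map_add' := fun x y ↦ hinj (by simp [hg])
      map_smul' := fun a x ↦ hinj (by
        have : ((f a • g x : T) : WittVector p R) = g x * frobenius (a : WittVector p R) :=
          mul_comm _ _
        rw [this, verschiebung_mul_frobenius, hg, hg]
        exact mul_comm _ _) }
  have hspan : Ideal.span (Set.range ⇑f₁) = ⊤ := by
    refine (Ideal.eq_top_iff_one _).mpr (Ideal.subset_span ?_)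
    have hv : verschiebung (1 : WittVector p R) ∈ T := hT.verschiebung_mem hp3 hpm (one_mem T)
    exact ⟨⟨⟨_, hv⟩, (hI' _).mpr ⟨1, rfl⟩⟩, hinj (hg _)⟩
  refine ⟨⟨hlocal, I, f, f₁, hspan⟩, hI, hI', fun _ ↦ rfl, hg, fun x ↦ Subtype.ext ?_⟩
  change frobenius ((x : T) : WittVector p R) = p * (g x : WittVector p R)
  rw [← hg, frobenius_verschiebung, mul_comm]
end
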